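/- arXiv:2210.05627 — 3 statements merged into one kernel-verified Lean document; each statement's English description precedes it below -/
import Mathlib

section
/- For every t ∈ [0,1] and every even integer s ≥ 2, γ_{s,4}(t) := ℙ(D_s(t) ∩ M_4(t)) = −(1−t) e^{−t} [ (1/2) ∑_{i=3}^{s} (−2t)^i/i! + (1−t) ∑_{i=0}^{s/2−2} t^{2i+3}/(2i+3)! ], where the second sum is empty when s = 2. -/
open MeasureTheory Set

/-- `P` is the infinite product over `ℤ` of the uniform probability measure on `[0,1]`,
characterized by its values on cylinder sets. -/
def IsUniformProduct (P : Measure (ℤ → ℝ)) : Prop :=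
  ∀ (F : Finset ℤ) (A : ℤ → Set ℝ), (∀ i ∈ F, MeasurableSet (A i)) →
    P {T | ∀ i ∈ F, T i ∈ A i} = ∏ i ∈ F, (volume.restrict (Icc (0 : ℝ) 1)) (A i)

/-- The event `G_{jk}^s(t)`. -/
def G (t : ℝ) (s : ℤ) (j k : ℕ) : Set (ℤ → ℝ) :=
  {T | T s < t ∧
    (∀ i : ℕ, i < 2 * j → T (s - i - 1) < T (s - i)) ∧
    T (s - 2 * j) < T (s - 2 * j - 1) ∧
    (∀ i : ℕ, i < 2 * k → T (s + i + 1) < T (s + i)) ∧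
    T (s + 2 * k) < T (s + 2 * k + 1)}

/-- The event that site `s` is occupied by time `t`. -/
def O (t : ℝ) (s : ℤ) : Set (ℤ → ℝ) := ⋃ (j : ℕ) (k : ℕ), G t s j k

/-- The event that sites `-1` and `0` are vacant and site `s` is occupied at time `t`. -/
def D (t : ℝ) (s : ℤ) : Set (ℤ → ℝ) := (O t (-1))ᶜ ∩ (O t 0)ᶜ ∩ O t s

def M1 (t : ℝ) : Set (ℤ → ℝ) := {T | t < T (-1) ∧ t < T 0}
def M2 (t : ℝ) : Set (ℤ → ℝ) := {T | T (-1) < t ∧ T 0 < t}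
def M3 (t : ℝ) : Set (ℤ → ℝ) := {T | T (-1) < t ∧ t < T 0}
def M4 (t : ℝ) : Set (ℤ → ℝ) := {T | T 0 < t ∧ t < T (-1)}

noncomputable section GammaProof

namespace GammaAux

/-- uniform measure -/
def mu : Measure ℝ := volume.restrict (Icc (0 : ℝ) 1)

instance : IsProbabilityMeasure mu := ⟨by simp [mu]⟩

theorem prob_P {P : Measure (ℤ → ℝ)} (hP : IsUniformProduct P) : IsProbabilityMeasure P := by
  constructor
  have := hP ∅ (fun _ => univ) (by simp)
  simpa using this

theorem eq_inf {P : Measure (ℤ → ℝ)} (hP : IsUniformProduct P) :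
    P = Measure.infinitePi (fun _ : ℤ => mu) := by
  apply Measure.eq_infinitePi
  intro s A hA
  have := hP s A (fun i _ => hA i)
  simpa [mu, Set.pi] using this

theorem map_update {P : Measure (ℤ → ℝ)} (hP : IsUniformProduct P) (n : ℤ) :
    (mu.prod P).map (fun p : ℝ × (ℤ → ℝ) => Function.update p.2 n p.1) = P := by
  have := prob_P hP
  have hm : Measurable (fun p : ℝ × (ℤ → ℝ) => Function.update p.2 n p.1) := by
    rw [measurable_pi_iff]
    intro i
    by_cases h : i = n
    · subst h; simpa using measurable_fst
    · simp only [Function.update_of_ne h]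
      exact (measurable_pi_apply i).comp measurable_snd
  conv_rhs => rw [eq_inf hP]
  apply Measure.eq_infinitePi
  intro s A hA
  rw [Measure.map_apply hm (MeasurableSet.pi s.countable_toSet (fun i _ => hA i))]
  by_cases hn : n ∈ s
  · have : (fun p : ℝ × (ℤ → ℝ) => Function.update p.2 n p.1) ⁻¹' (Set.pi s A)
        = A n ×ˢ {T | ∀ i ∈ s.erase n, T i ∈ A i} := by
      ext p
      simp only [mem_preimage, Set.mem_pi, mem_prod, Set.mem_ofPred_eq, Finset.mem_coe, Finset.mem_erase]
      constructor
      · intro h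
        refine ⟨by simpa using h n hn, fun i hi => ?_⟩
        simpa [Function.update_of_ne hi.1] using h i hi.2
      · rintro ⟨h1, h2⟩ i hi
        by_cases h : i = n
        · subst h; simpa using h1
        · simpa [Function.update_of_ne h] using h2 i ⟨h, hi⟩
    rw [this, Measure.prod_prod, hP _ _ (fun i _ => hA i), ← Finset.mul_prod_erase s _ hn]
    rfl
  · have : (fun p : ℝ × (ℤ → ℝ) => Function.update p.2 n p.1) ⁻¹' (Set.pi s A)
        = univ ×ˢ {T | ∀ i ∈ s, T i ∈ A i} := by
      ext p
      simp only [mem_preimage, Set.mem_pi, mem_prod, Set.mem_ofPred_eq, Finset.mem_coe, mem_univ,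
        true_and]
      refine forall₂_congr fun i hi => ?_
      have h : i ≠ n := fun h => hn (h ▸ hi)
      simp [Function.update_of_ne h]
    rw [this, Measure.prod_prod, hP _ _ (fun i _ => hA i)]
    simp [mu]

/-- resampling lemma -/
theorem fub {P : Measure (ℤ → ℝ)} (hP : IsUniformProduct P) (n : ℤ)
    (S : ℝ → (ℤ → ℝ) → Prop) (hS : MeasurableSet {p : ℝ × (ℤ → ℝ) | S p.1 p.2})
    (hinv : ∀ y T z, S y (Function.update T n z) ↔ S y T) :
    P.real {T | S (T n) T} = ∫ y in (0:ℝ)..1, P.real {T | S y T} := by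
  have := prob_P hP
  have hm : Measurable (fun p : ℝ × (ℤ → ℝ) => Function.update p.2 n p.1) := by
    rw [measurable_pi_iff]
    intro i
    by_cases h : i = n
    · subst h; simpa using measurable_fst
    · simp only [Function.update_of_ne h]
      exact (measurable_pi_apply i).comp measurable_snd
  have hB : MeasurableSet {T : ℤ → ℝ | S (T n) T} := by
    have : Measurable (fun T : ℤ → ℝ => (T n, T)) := (measurable_pi_apply n).prodMk measurable_id
    exact this hS
  have h1 : P {T | S (T n) T} = ∫⁻ y, P {T | S y T} ∂mu := by
    conv_lhs => rw [← map_update hP n]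
    rw [Measure.map_apply hm hB]
    have : (fun p : ℝ × (ℤ → ℝ) => Function.update p.2 n p.1) ⁻¹' {T | S (T n) T}
        = {p : ℝ × (ℤ → ℝ) | S p.1 p.2} := by
      ext p; simp [hinv]
    rw [this, Measure.prod_apply hS]
    rfl
  have h2 : Measurable (fun y => P {T | S y T}) := measurable_measure_prodMk_left hS
  rw [Measure.real, h1, ← integral_toReal h2.aemeasurable (by simp), mu,
    intervalIntegral.integral_of_le zero_le_one, integral_Icc_eq_integral_Ioc]
  rfl

theorem fub_lt {P : Measure (ℤ → ℝ)} (hP : IsUniformProduct P) (n : ℤ)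
    (S : ℝ → (ℤ → ℝ) → Prop) (hS : MeasurableSet {p : ℝ × (ℤ → ℝ) | S p.1 p.2})
    (hinv : ∀ y T z, S y (Function.update T n z) ↔ S y T) (x : ℝ) (hx : x ∈ Icc (0:ℝ) 1) :
    P.real {T | T n < x ∧ S (T n) T} = ∫ y in (0:ℝ)..x, P.real {T | S y T} := by
  rw [fub hP n (fun y T => y < x ∧ S y T)
    ((measurableSet_lt measurable_fst measurable_const).inter hS) (by simp [hinv])]
  have : ∀ y, P.real {T | y < x ∧ S y T} = (Iio x).indicator (fun y => P.real {T | S y T}) y := by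
    intro y
    by_cases h : y < x <;> simp [h]
  simp_rw [this]
  rw [intervalIntegral.integral_of_le zero_le_one, intervalIntegral.integral_of_le hx.1,
    ← integral_Ico_eq_integral_Ioc, setIntegral_indicator measurableSet_Iio]
  rw [← integral_Ico_eq_integral_Ioc]
  congr 2
  ext y; simp only [mem_inter_iff, mem_Ico, mem_Iio]
  constructor
  · rintro ⟨⟨a, b⟩, c⟩; exact ⟨a, c⟩
  · rintro ⟨a, b⟩; exact ⟨⟨a, b.trans_le hx.2⟩, b⟩

theorem fub_gt {P : Measure (ℤ → ℝ)} (hP : IsUniformProduct P) (n : ℤ)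
    (H : (ℤ → ℝ) → Prop) (hH : MeasurableSet {T | H T})
    (hinv : ∀ T z, H (Function.update T n z) ↔ H T) (x : ℝ) (hx : x ∈ Icc (0:ℝ) 1) :
    P.real {T | x < T n ∧ H T} = (1 - x) * P.real {T | H T} := by
  rw [fub hP n (fun y T => x < y ∧ H T)
    ((measurableSet_lt measurable_const measurable_fst).inter (measurable_snd hH)) (by simp [hinv])]
  have : ∀ y, P.real {T | x < y ∧ H T} = (Ioi x).indicator (fun _ => P.real {T | H T}) y := by
    intro y
    by_cases h : x < y <;> simp [h]
  simp_rw [this]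
  rw [intervalIntegral.integral_of_le zero_le_one, setIntegral_indicator measurableSet_Ioi]
  have : Ioc (0:ℝ) 1 ∩ Ioi x = Ioc x 1 := by
    ext y; simp only [mem_inter_iff, mem_Ioc, mem_Ioi]
    constructor
    · rintro ⟨⟨a, b⟩, c⟩; exact ⟨c, b⟩
    · rintro ⟨a, b⟩; exact ⟨⟨hx.1.trans_lt a, b⟩, a⟩
  rw [this]
  simp [hx.2]

theorem no_tie {P : Measure (ℤ → ℝ)} (hP : IsUniformProduct P) :
    ∀ᵐ T ∂P, ∀ n : ℤ, T n ≠ T (n + 1) := by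
  have := prob_P hP
  rw [ae_all_iff]
  intro n
  rw [ae_iff]
  have h := fub hP n (fun y T => y = T (n+1))
    (measurableSet_eq_fun measurable_fst ((measurable_pi_apply _).comp measurable_snd))
    (by intro y T z; simp [Function.update_of_ne])
  have h0 : ∀ y, P.real {T : ℤ → ℝ | y = T (n+1)} = 0 := by
    intro y
    have h := hP {n+1} (fun _ => {y}) (by simp)
    have : {T : ℤ → ℝ | y = T (n+1)} = {T | ∀ i ∈ ({n+1} : Finset ℤ), T i ∈ ({y} : Set ℝ)} := by
      ext T; simp [eq_comm]
    rw [Measure.real, this, h]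
    simp
  simp only [h0] at h
  simp only [not_not]
  rw [intervalIntegral.integral_zero] at h
  exact (measureReal_eq_zero_iff).1 h

/-! ### analysis -/

def p (k : ℕ) (u : ℝ) : ℝ := u ^ k / (Nat.factorial k)

theorem p_zero (u : ℝ) : p 0 u = 1 := by simp [p]
theorem p_succ_zero (k : ℕ) : p (k+1) 0 = 0 := by simp [p]

theorem p_deriv (k : ℕ) (u : ℝ) : HasDerivAt (p (k+1)) (p k u) u := by
  have := (hasDerivAt_pow (k+1) u).div_const ((Nat.factorial (k+1) : ℕ) : ℝ)
  unfold p
  refine this.congr_deriv ?_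
  have h1 : ((Nat.factorial k : ℕ) : ℝ) ≠ 0 := by positivity
  rw [Nat.factorial_succ]
  push_cast
  field_simp

theorem p_cont (k : ℕ) : Continuous (p k) := by unfold p; fun_prop

def c (t : ℝ) (n : ℕ) : ℝ := ∑ i ∈ Finset.range (n+2), p i (-t) - (1 - t)

theorem c_zero (t : ℝ) : c t 0 = 0 := by simp [c, Finset.sum_range_succ, p]
theorem c_succ (t : ℝ) (n : ℕ) : c t (n+1) = c t n + p (n+2) (-t) := by
  simp only [c]; rw [Finset.sum_range_succ]; ring

def Q (t : ℝ) (n : ℕ) (x : ℝ) : ℝ := c t n - p (n+1) (x - t)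

def dl (t : ℝ) (n : ℕ) (x : ℝ) : ℝ :=
  -(1/2) * (p (n+1) (x-t) - p n (x-t)) + (1/2) * (p (n+1) (-x-t) + p n (-x-t))
    - (1 - t) * p n (-x)

def phi (t : ℝ) : ℕ → ℝ → ℝ
  | 0, _ => 0
  | n+1, x => phi t n x + dl t n x

theorem dp1 (t : ℝ) (k : ℕ) (x : ℝ) : HasDerivAt (fun x => p (k+1) (x - t)) (p k (x-t)) x := by
  have h := (p_deriv k (x-t)).comp x ((hasDerivAt_id x).sub_const t)
  exact h.congr_deriv (by simp)
theorem dp2 (t : ℝ) (k : ℕ) (x : ℝ) : HasDerivAt (fun x => p (k+1) (-x - t)) (-p k (-x-t)) x := by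
  have h := (p_deriv k (-x-t)).comp x ((hasDerivAt_neg x).sub_const t)
  exact h.congr_deriv (by simp)
theorem dp3 (k : ℕ) (x : ℝ) : HasDerivAt (fun x => p (k+1) (-x)) (-p k (-x)) x := by
  have h := (p_deriv k (-x)).comp x (hasDerivAt_neg x)
  exact h.congr_deriv (by simp)

theorem dl_deriv (t : ℝ) (n : ℕ) (x : ℝ) :
    HasDerivAt (dl t (n+1)) (-p (n+1) (x-t) + p n (x-t) - dl t n x) x := by
  have := ((((dp1 t (n+1) x).sub (dp1 t n x)).const_mul (-(1/2))).add
    (((dp2 t (n+1) x).add (dp2 t n x)).const_mul (1/2))).sub ((dp3 n x).const_mul (1-t))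
  refine HasDerivAt.congr_deriv (f := dl t (n+1)) this ?_
  simp only [dl]; ring

theorem phi_one (t x : ℝ) : phi t 1 x = t - x := by
  simp [phi, dl, p]; ring

theorem phi_deriv (t : ℝ) (n : ℕ) (x : ℝ) :
    HasDerivAt (phi t (n+1)) (-p n (x-t) - phi t n x) x := by
  induction n with
  | zero =>
    have : phi t 1 = fun x => t - x := by funext x; exact phi_one t x
    rw [zero_add, this]
    simpa [phi, p] using (hasDerivAt_id x).const_sub t
  | succ n ih =>
    have h := ih.add (dl_deriv t n x)
    have : phi t (n+1+1) = phi t (n+1) + dl t (n+1) := by funext y; rfl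
    rw [this]
    refine h.congr_deriv ?_
    simp only [phi]; ring

theorem dl_zero (t : ℝ) (n : ℕ) : dl t (n+1) 0 = p (n+1) (-t) := by
  simp [dl, p_succ_zero]; ring

theorem phi_zero (t : ℝ) (n : ℕ) : phi t (n+2) 0 = c t n := by
  induction n with
  | zero =>
    rw [c_zero]
    change phi t 1 0 + dl t 1 0 = 0
    rw [phi_one, dl_zero]; simp [p]
  | succ n ih =>
    change phi t (n+2) 0 + dl t (n+2) 0 = _
    rw [ih, c_succ, dl_zero]

theorem phi_cont (t : ℝ) (n : ℕ) : Continuous (phi t n) := by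
  cases n with
  | zero => exact continuous_const
  | succ n => exact continuous_iff_continuousAt.2 fun x => (phi_deriv t n x).continuousAt

theorem Q_cont (t : ℝ) (n : ℕ) : Continuous (Q t n) := by
  unfold Q
  exact continuous_const.sub ((p_cont _).comp (by fun_prop))

theorem phi_int (t : ℝ) (n : ℕ) (x : ℝ) :
    (1 - x) * c t n + ∫ y in (0:ℝ)..x, (Q t n y - phi t (n+1) y) = phi t (n+2) x := by
  have h := intervalIntegral.integral_eq_sub_of_hasDerivAt (a := 0) (b := x)
    (f := fun y => phi t (n+2) y + c t n * y) (f' := fun y => Q t n y - phi t (n+1) y)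
    (fun y _ => by
      have := (phi_deriv t (n+1) y).add ((hasDerivAt_id y).const_mul (c t n))
      refine HasDerivAt.congr_deriv (f := fun y => phi t (n+2) y + c t n * y) this ?_
      simp [Q]; ring)
    (((Q_cont t n).sub (phi_cont t _)).intervalIntegrable _ _)
  rw [h, phi_zero]; ring

theorem Q_int (t : ℝ) (n : ℕ) (x : ℝ) :
    ∫ y in (0:ℝ)..x, Q t n y = c t n * x - p (n+2) (x-t) + p (n+2) (-t) := by
  have h := intervalIntegral.integral_eq_sub_of_hasDerivAt (a := 0) (b := x)
    (f := fun y => c t n * y - p (n+2) (y - t)) (f' := fun y => Q t n y)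
    (fun y _ => by
      have := ((hasDerivAt_id y).const_mul (c t n)).sub (dp1 t (n+1) y)
      refine HasDerivAt.congr_deriv (f := fun y => c t n * y - p (n+2) (y - t)) this ?_
      simp [Q])
    ((Q_cont t n).intervalIntegrable _ _)
  rw [h]; simp

theorem I_step (t : ℝ) (n : ℕ) :
    ∫ x in (0:ℝ)..t, Real.exp (-x) * phi t (n+2) x = (∫ x in (0:ℝ)..t, Real.exp (-x) * phi t n x)
      - Real.exp (-t) * ((1/2) * (p (n+2) (-2*t) + p (n+1) (-2*t)) - (1-t) * p (n+1) (-t)) := by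
  have ce : Continuous fun x : ℝ => Real.exp (-x) := by fun_prop
  have h := intervalIntegral.integral_eq_sub_of_hasDerivAt (a := 0) (b := t)
    (f := fun y => Real.exp (-y) * (p (n+1) (y-t) - dl t (n+1) y))
    (f' := fun y => Real.exp (-y) * phi t (n+2) y - Real.exp (-y) * phi t n y)
    (fun y _ => by
      have := ((hasDerivAt_neg y).exp).mul ((dp1 t n y).sub (dl_deriv t n y))
      refine HasDerivAt.congr_deriv (f := fun y => Real.exp (-y) * (p (n+1) (y-t) - dl t (n+1) y))
        this ?_
      simp only [phi, Pi.sub_apply]; ring)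
    (((ce.mul (phi_cont t _)).sub (ce.mul (phi_cont t _))).intervalIntegrable _ _)
  have ci : ∀ m, IntervalIntegrable (fun x => Real.exp (-x) * phi t m x) volume 0 t :=
    fun m => (ce.mul (phi_cont t m)).intervalIntegrable _ _
  rw [intervalIntegral.integral_sub (ci _) (ci _)] at h
  rw [dl_zero] at h
  have e : dl t (n+1) t = (1/2) * (p (n+2) (-2*t) + p (n+1) (-2*t)) - (1-t) * p (n+1) (-t) := by
    have : -t - t = -2*t := by ring
    simp [dl, p_succ_zero, this]
  rw [e] at h
  simp only [sub_self, p_succ_zero, zero_sub, neg_zero, Real.exp_zero] at h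
  linarith

theorem I_formula (t : ℝ) (m : ℕ) :
    ∫ x in (0:ℝ)..t, Real.exp (-x) * phi t (2*m+2) x = - Real.exp (-t) *
      ((1 / 2) * ∑ i ∈ Finset.Icc 3 (2*m+2), (-2 * t) ^ i / (Nat.factorial i) +
          (1 - t) *
            ∑ i ∈ Finset.range m, t ^ (2 * i + 3) / (Nat.factorial (2 * i + 3))) := by
  induction m with
  | zero =>
    rw [I_step]
    simp [phi, p]
    ring
  | succ m ih =>
    rw [show 2*(m+1)+2 = (2*m+2)+2 by ring, I_step, ih,
      Finset.sum_Icc_succ_top (show 3 ≤ 2*m+2+1+1 by omega),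
      Finset.sum_Icc_succ_top (show 3 ≤ 2*m+2+1 by omega), Finset.sum_range_succ]
    have : p (2*m+2+1) (-t) = - (t ^ (2*m+3) / (Nat.factorial (2*m+3))) := by
      unfold p
      rw [Odd.neg_pow ⟨m+1, by ring⟩]
      ring
    rw [this]
    simp only [p]
    ring

/-! ### window events -/

def q (t : ℝ) (T : ℤ → ℝ) : ℕ → ℝ → Prop
  | 0, _ => False
  | 1, x => x < T 0 ∧ T 0 < t
  | n+2, x => (x < T ((n+1 : ℕ) : ℤ) ∧ q t T n (T (n : ℤ))) ∨
      (T ((n+1 : ℕ) : ℤ) < x ∧ q t T (n+1) (T ((n+1 : ℕ) : ℤ)))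

def f (t : ℝ) (T : ℤ → ℝ) : ℕ → ℝ → Prop
  | 0, _ => False
  | 1, x => x < T 0 ∧ T 0 < t
  | n+2, x => (x < T ((n+1 : ℕ) : ℤ) ∧ q t T n (T (n : ℤ))) ∨
      (T ((n+1 : ℕ) : ℤ) < x ∧ q t T (n+1) (T ((n+1 : ℕ) : ℤ)) ∧
        ¬ f t T (n+1) (T ((n+1 : ℕ) : ℤ)))

theorem f_q {t : ℝ} {T : ℤ → ℝ} {n : ℕ} {x : ℝ} (h : f t T n x) : q t T n x := by
  match n with
  | 0 => exact h
  | 1 => exact h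
  | n+2 =>
    simp only [f] at h
    simp only [q]
    tauto

theorem q_congr (t : ℝ) {T T' : ℤ → ℝ} : ∀ (n : ℕ) (x : ℝ),
    (∀ i : ℤ, 0 ≤ i → i < n → T i = T' i) → (q t T n x ↔ q t T' n x)
  | 0, x, _ => Iff.rfl
  | 1, x, h => by simp [q, h 0 le_rfl (by norm_num)]
  | n+2, x, h => by
    have h1 := h ((n+1 : ℕ) : ℤ) (by omega) (by push_cast; omega)
    have h0 := h (n : ℤ) (by omega) (by push_cast; omega)
    simp only [q]
    rw [h1, h0, q_congr t n _ (fun i h0 hi => h i h0 (by push_cast; omega)),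
      q_congr t (n+1) _ (fun i h0 hi => h i h0 (by push_cast at *; omega))]

theorem f_congr (t : ℝ) {T T' : ℤ → ℝ} : ∀ (n : ℕ) (x : ℝ),
    (∀ i : ℤ, 0 ≤ i → i < n → T i = T' i) → (f t T n x ↔ f t T' n x)
  | 0, x, _ => Iff.rfl
  | 1, x, h => by simp [f, h 0 le_rfl (by norm_num)]
  | n+2, x, h => by
    have h1 := h ((n+1 : ℕ) : ℤ) (by omega) (by push_cast; omega)
    have h0 := h (n : ℤ) (by omega) (by push_cast; omega)
    simp only [f]
    rw [h1, h0, q_congr t n _ (fun i h0 hi => h i h0 (by push_cast; omega)),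
      q_congr t (n+1) _ (fun i h0 hi => h i h0 (by push_cast at *; omega)),
      f_congr t (n+1) _ (fun i h0 hi => h i h0 (by push_cast at *; omega))]

theorem meas_sub (S : ℝ → (ℤ → ℝ) → Prop) (hS : MeasurableSet {p : ℝ × (ℤ → ℝ) | S p.1 p.2})
    (n : ℤ) : MeasurableSet {p : ℝ × (ℤ → ℝ) | S (p.2 n) p.2} := by
  have : Measurable (fun p : ℝ × (ℤ → ℝ) => (p.2 n, p.2)) :=
    ((measurable_pi_apply n).comp measurable_snd).prodMk measurable_snd
  exact this hS

theorem meas_at (S : ℝ → (ℤ → ℝ) → Prop) (hS : MeasurableSet {p : ℝ × (ℤ → ℝ) | S p.1 p.2})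
    (n : ℤ) : MeasurableSet {T : ℤ → ℝ | S (T n) T} := by
  have : Measurable (fun T : ℤ → ℝ => (T n, T)) := (measurable_pi_apply n).prodMk measurable_id
  exact this hS

theorem meas_sec (S : ℝ → (ℤ → ℝ) → Prop) (hS : MeasurableSet {p : ℝ × (ℤ → ℝ) | S p.1 p.2})
    (x : ℝ) : MeasurableSet {T : ℤ → ℝ | S x T} := by
  have : Measurable (fun T : ℤ → ℝ => (x, T)) := measurable_const.prodMk measurable_id
  exact this hS

theorem meas_lt1 (n : ℤ) : MeasurableSet {p : ℝ × (ℤ → ℝ) | p.1 < p.2 n} :=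
  measurableSet_lt measurable_fst ((measurable_pi_apply n).comp measurable_snd)

theorem meas_lt2 (n : ℤ) : MeasurableSet {p : ℝ × (ℤ → ℝ) | p.2 n < p.1} :=
  measurableSet_lt ((measurable_pi_apply n).comp measurable_snd) measurable_fst

theorem q_meas (t : ℝ) : ∀ n : ℕ, MeasurableSet {p : ℝ × (ℤ → ℝ) | q t p.2 n p.1}
  | 0 => by simp [q]
  | 1 => (meas_lt1 0).inter
      (measurableSet_lt ((measurable_pi_apply 0).comp measurable_snd) measurable_const)
  | n+2 => ((meas_lt1 _).inter (meas_sub (fun x T => q t T n x) (q_meas t n) n)).union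
      ((meas_lt2 _).inter (meas_sub (fun x T => q t T (n+1) x) (q_meas t (n+1)) _))

theorem f_meas (t : ℝ) : ∀ n : ℕ, MeasurableSet {p : ℝ × (ℤ → ℝ) | f t p.2 n p.1}
  | 0 => by simp [f]
  | 1 => (meas_lt1 0).inter
      (measurableSet_lt ((measurable_pi_apply 0).comp measurable_snd) measurable_const)
  | n+2 => ((meas_lt1 _).inter (meas_sub (fun x T => q t T n x) (q_meas t n) n)).union
      ((meas_lt2 _).inter ((meas_sub (fun x T => q t T (n+1) x) (q_meas t (n+1)) _).inter
        (meas_sub (fun x T => f t T (n+1) x) (f_meas t (n+1)) _).compl))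

theorem upd {T : ℤ → ℝ} {n i : ℤ} {z : ℝ} (h : i ≠ n) : Function.update T n z i = T i :=
  Function.update_of_ne h _ _

/-- Probability of the first step. -/
theorem base_prob {P : Measure (ℤ → ℝ)} (hP : IsUniformProduct P) {t : ℝ}
    (ht : t ∈ Icc (0:ℝ) 1) {x : ℝ} (hx : 0 ≤ x) :
    P.real {T | x < T 0 ∧ T 0 < t} = max (t - x) 0 := by
  have h := hP {0} (fun _ => Ioo x t) (by simp)
  have : {T : ℤ → ℝ | x < T 0 ∧ T 0 < t}
      = {T | ∀ i ∈ ({0} : Finset ℤ), T i ∈ Ioo x t} := by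
    ext T; simp
  rw [Measure.real, this, h, Finset.prod_singleton, Measure.restrict_apply measurableSet_Ioo,
    inter_eq_left.2 (show Ioo x t ⊆ Icc 0 1 from
      fun y hy => ⟨hx.trans hy.1.le, hy.2.le.trans ht.2⟩), Real.volume_Ioo,
    ENNReal.toReal_ofReal']

theorem rec_prob {P : Measure (ℤ → ℝ)} (hP : IsUniformProduct P) (t : ℝ) (n : ℕ)
    (S : ℝ → (ℤ → ℝ) → Prop) (hS : MeasurableSet {p : ℝ × (ℤ → ℝ) | S p.1 p.2})
    (hinv : ∀ y T z, S y (Function.update T ((n+1 : ℕ) : ℤ) z) ↔ S y T)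
    {x : ℝ} (hx : x ∈ Icc (0:ℝ) 1) :
    P.real {T | (x < T ((n+1 : ℕ) : ℤ) ∧ q t T n (T (n : ℤ))) ∨
      (T ((n+1 : ℕ) : ℤ) < x ∧ S (T ((n+1 : ℕ) : ℤ)) T)}
      = (1 - x) * P.real {T | q t T n (T (n : ℤ))} + ∫ y in (0:ℝ)..x, P.real {T | S y T} := by
  have := prob_P hP
  rw [← fub_lt hP _ S hS hinv x hx, ← fub_gt hP ((n+1 : ℕ) : ℤ) (fun T => q t T n (T (n:ℤ)))
    (meas_at (fun x T => q t T n x) (q_meas t n) n) _ x hx]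
  · rw [← measureReal_union]
    · rfl
    · rw [Set.disjoint_left]
      intro T h1 h2
      exact lt_asymm h1.1 h2.1
    · exact (measurableSet_lt (measurable_pi_apply _) measurable_const).inter
        (meas_at S hS _)
  · intro T z
    rw [upd (by push_cast; omega)]
    apply q_congr
    intro i _ hi
    exact upd (by push_cast; omega)

theorem q_inv (t : ℝ) (n : ℕ) (y : ℝ) (T : ℤ → ℝ) (z : ℝ) :
    q t (Function.update T (n : ℤ) z) n y ↔ q t T n y :=
  q_congr _ _ _ (fun _ _ hi => upd hi.ne)

theorem f_inv (t : ℝ) (n : ℕ) (y : ℝ) (T : ℤ → ℝ) (z : ℝ) :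
    f t (Function.update T (n : ℤ) z) n y ↔ f t T n y :=
  f_congr _ _ _ (fun _ _ hi => upd hi.ne)

theorem q_rec {P : Measure (ℤ → ℝ)} (hP : IsUniformProduct P) (t : ℝ) (n : ℕ)
    {x : ℝ} (hx : x ∈ Icc (0:ℝ) 1) :
    P.real {T | q t T (n+2) x} = (1 - x) * P.real {T | q t T n (T (n : ℤ))}
      + ∫ y in (0:ℝ)..x, P.real {T | q t T (n+1) y} :=
  rec_prob hP t n (fun y T => q t T (n+1) y) (q_meas t _) (q_inv t (n+1)) hx

theorem f_rec {P : Measure (ℤ → ℝ)} (hP : IsUniformProduct P) (t : ℝ) (n : ℕ)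
    {x : ℝ} (hx : x ∈ Icc (0:ℝ) 1) :
    P.real {T | f t T (n+2) x} = (1 - x) * P.real {T | q t T n (T (n : ℤ))}
      + ∫ y in (0:ℝ)..x, (P.real {T | q t T (n+1) y} - P.real {T | f t T (n+1) y}) := by
  have := prob_P hP
  have h := rec_prob hP t n (fun y T => q t T (n+1) y ∧ ¬ f t T (n+1) y)
    ((q_meas t _).inter (f_meas t _).compl)
    (fun y T z => and_congr (q_inv t (n+1) y T z) (not_congr (f_inv t (n+1) y T z))) hx
  have e : ∀ y, P.real {T | q t T (n+1) y ∧ ¬ f t T (n+1) y}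
      = P.real {T | q t T (n+1) y} - P.real {T | f t T (n+1) y} := by
    intro y
    exact measureReal_sdiff (μ := P) (s₁ := {T | q t T (n+1) y}) (s₂ := {T | f t T (n+1) y})
      (fun T hT => f_q hT) (meas_sec (fun y T => f t T (n+1) y) (f_meas t _) y)
  simp only [e] at h
  exact h

/-- values of `q` -/
theorem q_val {P : Measure (ℤ → ℝ)} (hP : IsUniformProduct P) {t : ℝ}
    (ht : t ∈ Icc (0:ℝ) 1) (n : ℕ) :
    P.real {T | q t T n (T (n:ℤ))} = c t n ∧
    (∀ x ∈ Icc 0 t, P.real {T | q t T (n+1) x} = Q t n x) ∧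
    (∀ x ∈ Icc t 1, P.real {T | q t T (n+1) x} = c t n) := by
  have := prob_P hP
  have key : ∀ n : ℕ, (∀ x ∈ Icc 0 t, P.real {T | q t T (n+1) x} = Q t n x) →
    (∀ x ∈ Icc t 1, P.real {T | q t T (n+1) x} = c t n) → ∀ x ∈ Icc t 1,
      ∫ y in (0:ℝ)..x, P.real {T | q t T (n+1) y} = (c t n * t + p (n+2) (-t)) + (x-t) * c t n := by
    intro n h1 h2 x hx
    have e1 : EqOn (fun y => Q t n y) (fun y => P.real {T | q t T (n+1) y}) (uIcc 0 t) := by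
      intro y hy; rw [uIcc_of_le ht.1] at hy; exact (h1 y hy).symm
    have e2 : EqOn (fun y => c t n) (fun y => P.real {T | q t T (n+1) y}) (uIcc t x) := by
      intro y hy; rw [uIcc_of_le hx.1] at hy; exact (h2 y ⟨hy.1, hy.2.trans hx.2⟩).symm
    rw [← intervalIntegral.integral_add_adjacent_intervals (b := t),
      ← intervalIntegral.integral_congr e1, ← intervalIntegral.integral_congr e2, Q_int]
    · simp [p_succ_zero]
    · exact IntervalIntegrable.congr (e1.mono uIoc_subset_uIcc) ((Q_cont t n).intervalIntegrable _ _)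
    · exact IntervalIntegrable.congr (e2.mono uIoc_subset_uIcc) intervalIntegrable_const
  induction n with
  | zero =>
    refine ⟨by simp [q, c_zero], fun x hx => ?_, fun x hx => ?_⟩
    · have := base_prob hP ht hx.1
      simp only [zero_add, q]
      rw [this, max_eq_left (by linarith [hx.2])]
      simp [Q, c_zero, p]
    · have := base_prob hP ht (ht.1.trans hx.1)
      simp only [zero_add, q]
      rw [this, max_eq_right (by linarith [hx.1]), c_zero]
  | succ n ih =>
    obtain ⟨i0, i1, i2⟩ := ih
    have t1 : (1:ℝ) ∈ Icc t 1 := ⟨ht.2, le_refl _⟩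
    refine ⟨?_, fun x hx => ?_, fun x hx => ?_⟩
    · rw [fub hP _ (fun y T => q t T (n+1) y) (q_meas t _) (q_inv t (n+1)), key n i1 i2 1 t1, c_succ]
      ring
    · rw [q_rec hP t n ⟨hx.1, hx.2.trans ht.2⟩, i0]
      have e1 : EqOn (fun y => Q t n y) (fun y => P.real {T | q t T (n+1) y}) (uIcc 0 x) := by
        intro y hy; rw [uIcc_of_le hx.1] at hy; exact (i1 y ⟨hy.1, hy.2.trans hx.2⟩).symm
      rw [← intervalIntegral.integral_congr e1, Q_int, Q, c_succ]
      ring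
    · rw [q_rec hP t n ⟨ht.1.trans hx.1, hx.2⟩, i0, key n i1 i2 x hx, c_succ]
      ring

theorem f_val {P : Measure (ℤ → ℝ)} (hP : IsUniformProduct P) {t : ℝ}
    (ht : t ∈ Icc (0:ℝ) 1) (n : ℕ) :
    ∀ x ∈ Icc 0 t, P.real {T | f t T (n+1) x} = phi t (n+1) x := by
  induction n with
  | zero =>
    intro x hx
    have := base_prob hP ht hx.1
    simp only [zero_add, f]
    rw [this, max_eq_left (by linarith [hx.2]), phi_one]
  | succ n ih =>
    intro x hx
    rw [f_rec hP t n ⟨hx.1, hx.2.trans ht.2⟩, (q_val hP ht n).1, ← phi_int]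
    congr 1
    apply intervalIntegral.integral_congr
    intro y hy
    rw [uIcc_of_le hx.1] at hy
    have hyt : y ∈ Icc 0 t := ⟨hy.1, hy.2.trans hx.2⟩
    simp only [ih y hyt, (q_val hP ht n).2.1 y hyt]

/-! ### right chains -/

def Ch (T : ℤ → ℝ) : ℕ → ℤ → ℝ → Prop
  | 0, _, _ => True
  | m+1, n, x => T (n+1) < x ∧ Ch T m (n+1) (T (n+1))

theorem Ch_congr {T T' : ℤ → ℝ} (m : ℕ) : ∀ (n : ℤ) (x : ℝ),
    (∀ i : ℤ, n < i → T i = T' i) → (Ch T m n x ↔ Ch T' m n x) := by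
  induction m with
  | zero => intro n x _; exact Iff.rfl
  | succ m ih =>
    intro n x h
    simp only [Ch]
    rw [h (n+1) (by omega), ih (n+1) _ (fun i hi => h i (by omega))]

theorem Ch_meas (m : ℕ) : ∀ n : ℤ, MeasurableSet {p : ℝ × (ℤ → ℝ) | Ch p.2 m n p.1} := by
  induction m with
  | zero => intro n; simp [Ch]
  | succ m ih =>
    intro n
    exact (meas_lt2 _).inter (meas_sub (fun x T => Ch T m (n+1) x) (ih (n+1)) (n+1))

theorem Ch_prob {P : Measure (ℤ → ℝ)} (hP : IsUniformProduct P) (m : ℕ) :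
    ∀ (n : ℤ) (x : ℝ) (_ : x ∈ Icc (0:ℝ) 1) (H : (ℤ → ℝ) → Prop) (_ : MeasurableSet {T | H T})
    (_ : ∀ T z i, n < i → (H (Function.update T i z) ↔ H T)),
    P.real {T | H T ∧ Ch T m n x} = P.real {T | H T} * p m x := by
  induction m with
  | zero => intro n x _ H _ _; simp [Ch, p]
  | succ m ih =>
    intro n x hx H hH hi
    have h := fub_lt hP (n+1) (fun y T => H T ∧ Ch T m (n+1) y)
      ((measurable_snd hH).inter (Ch_meas m (n+1)))
      (fun y T z => and_congr (hi T z _ (by omega)) (Ch_congr _ _ _ (fun i hi => upd (by omega))))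
      x hx
    have e : {T | H T ∧ Ch T (m+1) n x} = {T | T (n+1) < x ∧ H T ∧ Ch T m (n+1) (T (n+1))} := by
      ext T; simp only [Ch, Set.mem_ofPred_eq]; tauto
    rw [e, h]
    have e1 : EqOn (fun y => P.real {T | H T ∧ Ch T m (n+1) y})
        (fun y => P.real {T | H T} * p m y) (uIcc 0 x) := by
      intro y hy
      rw [uIcc_of_le hx.1] at hy
      exact ih (n+1) y ⟨hy.1, hy.2.trans hx.2⟩ H hH (fun T z i h => hi T z i (by omega))
    rw [intervalIntegral.integral_congr e1, intervalIntegral.integral_const_mul,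
      intervalIntegral.integral_eq_sub_of_hasDerivAt (fun y _ => p_deriv m y)
        ((p_cont m).intervalIntegrable _ _), p_succ_zero, sub_zero]

/-- right chain has even length -/
def Rt (T : ℤ → ℝ) (n : ℤ) (x : ℝ) : Prop := ∃ k : ℕ, Ch T (2*k) n x ∧ ¬ Ch T (2*k+1) n x

theorem Ch_mono {T : ℤ → ℝ} (m : ℕ) : ∀ {n : ℤ} {x : ℝ}, Ch T (m+1) n x → Ch T m n x := by
  induction m with
  | zero => intros; trivial
  | succ m ih => intro n x h; exact ⟨h.1, ih h.2⟩

theorem Ch_anti {T : ℤ → ℝ} {m k : ℕ} (hmk : m ≤ k) {n : ℤ} {x : ℝ} (h : Ch T k n x) :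
    Ch T m n x := by
  induction hmk with
  | refl => exact h
  | step _ ih => exact ih (Ch_mono _ h)

theorem Rt_meas (n : ℤ) : MeasurableSet {p : ℝ × (ℤ → ℝ) | Rt p.2 n p.1} := by
  have : {p : ℝ × (ℤ → ℝ) | Rt p.2 n p.1} =
    ⋃ k : ℕ, ({p : ℝ × (ℤ → ℝ) | Ch p.2 (2*k) n p.1} \ {p | Ch p.2 (2*k+1) n p.1}) := by
    ext p; simp [Rt]
  rw [this]
  exact MeasurableSet.iUnion fun k => MeasurableSet.diff (Ch_meas _ n) (Ch_meas _ n)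

theorem Rt_congr {T T' : ℤ → ℝ} (n : ℤ) (x : ℝ)
    (h : ∀ i : ℤ, n < i → T i = T' i) : Rt T n x ↔ Rt T' n x :=
  exists_congr fun k => and_congr (Ch_congr _ _ _ h) (not_congr (Ch_congr _ _ _ h))

theorem hasSum_even (x : ℝ) : HasSum (fun k => p (2*k) x - p (2*k+1) x) (Real.exp (-x)) := by
  have h1 := Real.hasSum_cosh x
  have h2 := Real.hasSum_sinh x
  have := h1.sub h2
  rwa [Real.cosh_sub_sinh] at this

theorem Rt_prob {P : Measure (ℤ → ℝ)} (hP : IsUniformProduct P) (n : ℤ) (x : ℝ)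
    (hx : x ∈ Icc (0:ℝ) 1) (H : (ℤ → ℝ) → Prop) (hH : MeasurableSet {T | H T})
    (hi : ∀ T z i, n < i → (H (Function.update T i z) ↔ H T)) :
    P.real {T | H T ∧ Rt T n x} = P.real {T | H T} * Real.exp (-x) := by
  have := prob_P hP
  have hm : ∀ k, MeasurableSet {T | H T ∧ Ch T k n x} := fun k =>
    hH.inter (meas_sec (fun x T => Ch T k n x) (Ch_meas k n) x)
  let A : ℕ → Set (ℤ → ℝ) := fun k =>
    {T | H T ∧ Ch T (2*k) n x} \ {T | H T ∧ Ch T (2*k+1) n x}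
  have hA : ∀ k, P.real (A k) = P.real {T | H T} * (p (2*k) x - p (2*k+1) x) := by
    intro k
    simp only [A]
    rw [measureReal_sdiff _ (hm _), Ch_prob hP _ n x hx H hH hi, Ch_prob hP _ n x hx H hH hi]
    · ring
    · intro T hT; exact ⟨hT.1, Ch_mono _ hT.2⟩
  have hU : {T | H T ∧ Rt T n x} = ⋃ k, A k := by
    ext T; simp only [A, Rt, Set.mem_ofPred_eq, mem_iUnion, mem_sdiff]
    constructor
    · rintro ⟨h, k, a, b⟩; exact ⟨k, ⟨h, a⟩, fun h' => b h'.2⟩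
    · rintro ⟨k, ⟨h, a⟩, b⟩; exact ⟨h, k, a, fun h' => b ⟨h, h'⟩⟩
  have hd : Pairwise (Function.onFun Disjoint A) := by
    have aux : ∀ i j : ℕ, i < j → Disjoint (A i) (A j) := by
      intro i j hij
      rw [Set.disjoint_left]
      intro T h1 h2
      exact h1.2 ⟨h1.1.1, Ch_anti (by omega) h2.1.2⟩
    intro i j hij
    rcases lt_or_gt_of_ne hij with h | h
    · exact aux i j h
    · exact (aux j i h).symm
  have h1 : HasSum (fun k => P.real (A k)) (P.real (⋃ k, A k)) := by
    have e := measure_iUnion (μ := P) hd (fun k => MeasurableSet.diff (hm _) (hm _))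
    have hf : ∑' k, P (A k) ≠ ⊤ := by rw [← e]; exact measure_ne_top _ _
    have h := ENNReal.hasSum_toReal hf
    rw [← ENNReal.tsum_toReal_eq (fun k => measure_ne_top _ _), ← e] at h
    exact h
  rw [hU]
  simp only [hA] at h1
  exact h1.unique ((hasSum_even x).mul_left _)

theorem main_prob {P : Measure (ℤ → ℝ)} (hP : IsUniformProduct P) {t : ℝ}
    (ht : t ∈ Icc (0:ℝ) 1) (n : ℕ) :
    P.real {T | t < T (-1) ∧ T ((n+1:ℕ):ℤ) < t ∧ f t T (n+1) (T ((n+1:ℕ):ℤ)) ∧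
      Rt T ((n+1:ℕ):ℤ) (T ((n+1:ℕ):ℤ))} =
    (1 - t) * ∫ x in (0:ℝ)..t, Real.exp (-x) * phi t (n+1) x := by
  have := prob_P hP
  set N : ℤ := ((n+1:ℕ):ℤ) with hN
  have hN0 : 0 < N := by rw [hN]; push_cast; omega
  let S : ℝ → (ℤ → ℝ) → Prop := fun y T => f t T (n+1) y ∧ Rt T N y
  have hS : MeasurableSet {p : ℝ × (ℤ → ℝ) | S p.1 p.2} := (f_meas t _).inter (Rt_meas N)
  have hlt : MeasurableSet {p : ℝ × (ℤ → ℝ) | p.1 < t ∧ S p.1 p.2} :=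
    (measurableSet_lt measurable_fst measurable_const).inter hS
  have hSinv : ∀ y T z, S y (Function.update T N z) ↔ S y T := fun y T z =>
    and_congr (f_inv t (n+1) y T z) (Rt_congr _ _ (fun i hi => upd hi.ne'))
  have hSneg : ∀ y T z, S y (Function.update T (-1) z) ↔ S y T := fun y T z =>
    and_congr (f_congr _ _ _ (fun i h0 hi => upd (by omega)))
      (Rt_congr _ _ (fun i hi => upd (by omega)))
  have h1 := fub_gt hP (-1) (fun T => T N < t ∧ S (T N) T)
    (meas_at (fun y T => y < t ∧ S y T) hlt N)
    (fun T z => by rw [upd (show N ≠ -1 by omega), hSneg]) t ht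
  have h2 := fub_lt hP N S hS hSinv t ht
  rw [h2] at h1
  refine h1.trans ?_
  congr 1
  apply intervalIntegral.integral_congr
  intro x hx
  rw [uIcc_of_le ht.1] at hx
  have h3 := Rt_prob hP N x ⟨hx.1, hx.2.trans ht.2⟩ (fun T => f t T (n+1) x)
    (meas_sec (fun y T => f t T (n+1) y) (f_meas t _) x)
    (fun T z i hi => f_congr _ _ _ (fun j h0 hj => upd (by omega)))
  refine h3.trans ?_
  rw [f_val hP ht n x hx, mul_comm]

/-! ### pointwise description -/

theorem Ch_iff (T : ℤ → ℝ) (m : ℕ) : ∀ n : ℤ,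
    Ch T m n (T n) ↔ ∀ i : ℕ, i < m → T (n + i + 1) < T (n + i) := by
  induction m with
  | zero => intro n; simp [Ch]
  | succ m ih =>
    intro n
    simp only [Ch]
    rw [ih]
    constructor
    · rintro ⟨h1, h2⟩ i hi
      rcases i with _ | i
      · simpa using h1
      · have := h2 i (by omega)
        push_cast
        convert this using 2 <;> ring
    · intro h
      refine ⟨by simpa using h 0 (by omega), fun i hi => ?_⟩
      have := h (i+1) (by omega)
      push_cast at this
      convert this using 2 <;> ring

def NT (T : ℤ → ℝ) : Prop := ∀ n : ℤ, T n ≠ T (n + 1)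

theorem Rt_iff {T : ℤ → ℝ} (hT : NT T) (n : ℤ) : Rt T n (T n) ↔
    ∃ k : ℕ, (∀ i : ℕ, i < 2 * k → T (n + i + 1) < T (n + i)) ∧
      T (n + 2 * k) < T (n + 2 * k + 1) := by
  refine exists_congr fun k => ?_
  rw [Ch_iff, Ch_iff]
  refine and_congr_right fun h => ?_
  have hne := hT (n + 2 * k)
  constructor
  · intro h'
    by_contra hc
    apply h'
    intro i hi
    rcases Nat.lt_or_ge i (2*k) with h1 | h1
    · exact h i h1
    · have : i = 2*k := by omega
      subst this
      push_cast
      exact lt_of_le_of_ne (not_lt.1 hc) hne.symm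
  · intro h1 h2
    have := h2 (2*k) (by omega)
    push_cast at this
    exact lt_asymm h1 this

/-- reflected configuration -/
def rf (T : ℤ → ℝ) : ℤ → ℝ := fun i => T (-i)

theorem rf_NT {T : ℤ → ℝ} (hT : NT T) : NT (rf T) := by
  intro n h
  simp only [rf] at h
  apply hT (-(n+1))
  rw [← h]
  congr 1
  ring

def E (T : ℤ → ℝ) (n : ℤ) : Prop := Rt (rf T) (-n) (rf T (-n))
def R (T : ℤ → ℝ) (n : ℤ) : Prop := Rt T n (T n)

theorem E_iff {T : ℤ → ℝ} (hT : NT T) (n : ℤ) : E T n ↔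
    ∃ j : ℕ, (∀ i : ℕ, i < 2 * j → T (n - i - 1) < T (n - i)) ∧
      T (n - 2 * j) < T (n - 2 * j - 1) := by
  unfold E
  rw [Rt_iff (rf_NT hT)]
  refine exists_congr fun k => ?_
  simp only [rf]
  refine and_congr (forall₂_congr fun i _ => ?_) ?_
  · rw [show -(-n + (i:ℤ) + 1) = n - i - 1 by ring, show -(-n + (i:ℤ)) = n - i by ring]
  · rw [show -(-n + 2 * (k:ℤ) + 1) = n - 2 * k - 1 by ring,
      show -(-n + 2 * (k:ℤ)) = n - 2 * k by ring]

theorem O_iff {T : ℤ → ℝ} (hT : NT T) (t : ℝ) (n : ℤ) :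
    T ∈ O t n ↔ T n < t ∧ E T n ∧ R T n := by
  unfold R
  rw [E_iff hT, Rt_iff hT]
  simp only [O, G, mem_iUnion, Set.mem_ofPred_eq]
  constructor
  · rintro ⟨j, k, h1, h2, h3, h4, h5⟩
    exact ⟨h1, ⟨j, h2, h3⟩, ⟨k, h4, h5⟩⟩
  · rintro ⟨h1, ⟨j, h2, h3⟩, ⟨k, h4, h5⟩⟩
    exact ⟨j, k, h1, h2, h3, h4, h5⟩

def hlen (T : ℤ → ℝ) (n : ℤ) (m : ℕ) : Prop := ∀ j, Ch T j n (T n) ↔ j ≤ m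

theorem hlen_R {T : ℤ → ℝ} {n : ℤ} {m : ℕ} (h : hlen T n m) : Rt T n (T n) ↔ Even m := by
  simp only [Rt, h _]
  constructor
  · rintro ⟨k, h1, h2⟩; exact ⟨k, by omega⟩
  · rintro ⟨k, rfl⟩; exact ⟨k, by omega, by omega⟩

theorem R_hlen {T : ℤ → ℝ} {n : ℤ} (h : Rt T n (T n)) : ∃ m, hlen T n m := by
  obtain ⟨k, h1, h2⟩ := h
  refine ⟨2*k, fun j => ⟨fun hj => ?_, fun hj => Ch_anti hj h1⟩⟩
  by_contra hc
  exact h2 (Ch_anti (by omega) hj)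

theorem hlen_zero {T : ℤ → ℝ} {n : ℤ} (h : T n < T (n+1)) : hlen T n 0 := by
  intro j
  rcases j with _ | j
  · simp [Ch]
  · simp only [Ch]
    constructor
    · intro h'; exact absurd h'.1 (lt_asymm h)
    · intro h'; omega

theorem hlen_succ {T : ℤ → ℝ} {n : ℤ} {m : ℕ} (h : T (n+1) < T n) (hm : hlen T (n+1) m) :
    hlen T n (m+1) := by
  intro j
  rcases j with _ | j
  · simp [Ch]
  · simp only [Ch, hm j, h, true_and]
    omega

theorem hlen_ex {T : ℤ → ℝ} (hT : NT T) {n : ℤ} (h : ∃ m, hlen T (n+1) m) : ∃ m, hlen T n m := by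
  obtain ⟨m, hm⟩ := h
  rcases lt_or_gt_of_ne (hT n) with h | h
  · exact ⟨0, hlen_zero h⟩
  · exact ⟨m+1, hlen_succ h hm⟩

theorem Rt_rec {T : ℤ → ℝ} (hT : NT T) {n : ℤ} (h : ∃ m, hlen T (n+1) m) :
    Rt T n (T n) ↔ ¬ (T (n+1) < T n ∧ Rt T (n+1) (T (n+1))) := by
  obtain ⟨m, hm⟩ := h
  rcases lt_or_gt_of_ne (hT n) with h | h
  · rw [hlen_R (hlen_zero h)]
    simp [lt_asymm h]
  · rw [hlen_R (hlen_succ h hm), hlen_R hm, Nat.even_add_one]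
    simp [h]

theorem E_zero {T : ℤ → ℝ} (h : T 0 < T (-1)) : hlen (rf T) (-0) 0 := by
  apply hlen_zero
  simpa [rf] using h

theorem E_len {T : ℤ → ℝ} (hT : NT T) (h : T 0 < T (-1)) (n : ℕ) :
    ∃ m, hlen (rf T) (-(n:ℤ)) m := by
  induction n with
  | zero => exact ⟨0, by simpa using E_zero h⟩
  | succ n ih =>
    apply hlen_ex (rf_NT hT)
    rwa [show -((n+1:ℕ):ℤ) + 1 = -(n:ℤ) by push_cast; ring]

theorem E_rec {T : ℤ → ℝ} (hT : NT T) (h : T 0 < T (-1)) (n : ℕ) :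
    E T ((n+1:ℕ):ℤ) ↔ ¬ (T (n:ℤ) < T ((n+1:ℕ):ℤ) ∧ E T n) := by
  have e : -((n+1:ℕ):ℤ) + 1 = -(n:ℤ) := by push_cast; ring
  have := Rt_rec (rf_NT hT) (n := -((n+1:ℕ):ℤ)) (by rw [e]; exact E_len hT h n)
  rw [e] at this
  simpa [E, rf] using this

theorem q_T0 {t : ℝ} {T : ℤ → ℝ} : ∀ (n : ℕ) {x : ℝ}, q t T n x → T 0 < t
  | 0, _, h => h.elim
  | 1, _, h => h.2
  | n+2, _, h => by
    rcases h with h | h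
    · exact q_T0 n h.2
    · exact q_T0 (n+1) h.2

theorem q_R {t : ℝ} {T : ℤ → ℝ} (hT : NT T) (h0 : T 0 < t) : ∀ (n : ℕ), R T n →
    (q t T n (T n) ↔ ¬ R T 0)
  | 0, h => by simpa [q] using h
  | 1, h => by
    have hr := Rt_rec hT (n := 0) (by simpa using R_hlen h)
    simp only [R] at *
    rw [hr]
    simp only [q, Nat.cast_one, zero_add] at *
    tauto
  | n+2, h => by
    have hl2 : ∃ m, hlen T (((n+1:ℕ):ℤ)+1) m := by
      have := R_hlen h
      rwa [show ((n+2:ℕ):ℤ) = ((n+1:ℕ):ℤ)+1 by push_cast; ring] at this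
    have hl1 : ∃ m, hlen T ((n:ℤ)+1) m := by
      have := hlen_ex hT hl2
      rwa [show ((n+1:ℕ):ℤ) = (n:ℤ)+1 by push_cast; ring] at this
    have r1 := Rt_rec hT hl2
    have r0 := Rt_rec hT hl1
    rw [show ((n+1:ℕ):ℤ)+1 = ((n+2:ℕ):ℤ) by push_cast; ring] at r1
    rw [show (n:ℤ)+1 = ((n+1:ℕ):ℤ) by push_cast; ring] at r0
    have i0 := q_R hT h0 n
    have i1 := q_R hT h0 (n+1)
    have hne := hT ((n+1:ℕ):ℤ)
    rw [show ((n+1:ℕ):ℤ)+1 = ((n+2:ℕ):ℤ) by push_cast; ring] at hne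
    change R T _ ↔ ¬ (_ ∧ R T _) at r1
    change R T _ ↔ ¬ (_ ∧ R T _) at r0
    simp only [q]
    rcases lt_or_gt_of_ne hne with hc | hc
    · have := lt_asymm hc
      tauto
    · have := lt_asymm hc
      tauto

theorem f_E {t : ℝ} {T : ℤ → ℝ} (hT : NT T) (h : T 0 < T (-1)) : ∀ (n : ℕ),
    f t T n (T n) ↔ q t T n (T n) ∧ E T n
  | 0 => by simp [f, q]
  | 1 => by
    have := E_rec hT h 0
    simp only [f, q]
    simp only [zero_add, Nat.cast_zero, Nat.cast_one] at *
    constructor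
    · intro h'
      refine ⟨h', this.2 fun h2 => lt_asymm h2.1 h'.1⟩
    · exact fun h' => h'.1
  | n+2 => by
    have e := E_rec hT h (n+1)
    have i1 := f_E (t := t) hT h (n+1)
    have hne := hT ((n+1:ℕ):ℤ)
    rw [show ((n+1:ℕ):ℤ)+1 = ((n+2:ℕ):ℤ) by push_cast; ring] at hne
    rw [show ((n+1+1:ℕ):ℤ) = ((n+2:ℕ):ℤ) by push_cast; ring] at e
    simp only [f, q]
    rcases lt_or_gt_of_ne hne with hc | hc
    · have := lt_asymm hc
      tauto
    · have := lt_asymm hc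
      tauto

theorem event_iff {t : ℝ} {T : ℤ → ℝ} (hT : NT T) (n : ℕ) :
    T ∈ D t n ∩ M4 t ↔ t < T (-1) ∧ T (n:ℤ) < t ∧ f t T n (T (n:ℤ)) ∧ Rt T n (T (n:ℤ)) := by
  have hE0 : T 0 < T (-1) → E T 0 := fun h => by
    have := hlen_R (E_zero h)
    simpa [E] using this
  simp only [D, M4, mem_inter_iff, mem_compl_iff, O_iff hT, Set.mem_ofPred_eq]
  constructor
  · rintro ⟨⟨⟨-, h2⟩, h3, h4, h5⟩, h6, h7⟩
    refine ⟨h7, h3, ?_, h5⟩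
    rw [f_E hT (h6.trans h7)]
    refine ⟨(q_R hT h6 n h5).2 fun h => h2 ⟨h6, hE0 (h6.trans h7), h⟩, h4⟩
  · rintro ⟨h1, h2, h3, h4⟩
    have h0 : T 0 < t := q_T0 n (f_q h3)
    rw [f_E hT (h0.trans h1)] at h3
    refine ⟨⟨⟨fun h => lt_asymm h.1 h1, fun h => (q_R hT h0 n h4).1 h3.1 h.2.2⟩, h2, h3.2, h4⟩,
      h0, h1⟩

end GammaAux

end GammaProof

theorem gamma_four (P : Measure (ℤ → ℝ)) (hP : IsUniformProduct P)
    (t : ℝ) (ht : t ∈ Icc (0 : ℝ) 1) (s : ℕ) (hs : 2 ≤ s) (hse : Even s) :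
    (P (D t s ∩ M4 t)).toReal =
      -(1 - t) * Real.exp (-t) *
        ((1 / 2) * ∑ i ∈ Finset.Icc 3 s, (-2 * t) ^ i / (Nat.factorial i) +
          (1 - t) *
            ∑ i ∈ Finset.range (s / 2 - 1), t ^ (2 * i + 3) / (Nat.factorial (2 * i + 3))) := by
  obtain ⟨m, rfl⟩ : ∃ m, s = 2 * m + 2 := by
    obtain ⟨k, rfl⟩ := hse
    exact ⟨k - 1, by omega⟩
  have h1 : P (D t ((2 * m + 2 : ℕ) : ℤ) ∩ M4 t) = P {T | t < T (-1) ∧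
      T ((2*m+1+1:ℕ):ℤ) < t ∧ GammaAux.f t T (2*m+1+1) (T ((2*m+1+1:ℕ):ℤ)) ∧
      GammaAux.Rt T ((2*m+1+1:ℕ):ℤ) (T ((2*m+1+1:ℕ):ℤ))} := by
    apply measure_congr
    filter_upwards [GammaAux.no_tie hP] with T hT
    exact propext (GammaAux.event_iff hT (2*m+2))
  have h2 := GammaAux.main_prob hP ht (2*m+1)
  rw [h1]
  refine h2.trans ?_
  rw [GammaAux.I_formula, show (2*m+2)/2 - 1 = m by omega]
  ring
end

section
/- For every t ∈ [0,1] and every even integer s ≥ 2, γ_{s,1}(t) + γ_{s,3}(t) = e^{−2t} (1−t) ∑_{i=0}^{s/2−1} t^{2i+1}/(2i+1)!, where γ_{s,i}(t) := ℙ(D_s(t) ∩ M_i(t)). -/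
open MeasureTheory Set

noncomputable section
namespace RSA

/-- the uniform measure -/
abbrev mu : Measure ℝ := volume.restrict (Icc (0 : ℝ) 1)

instance : IsProbabilityMeasure mu := ⟨by simp [mu]⟩

open Classical in
/-- Merging two samples. -/
def merge (S : Set ℤ) (p : (ℤ → ℝ) × (ℤ → ℝ)) : ℤ → ℝ := fun i => if i ∈ S then p.1 i else p.2 i

lemma isProb {P : Measure (ℤ → ℝ)} (hP : IsUniformProduct P) : IsProbabilityMeasure P :=
  ⟨by simpa using hP ∅ (fun _ => univ) (by simp)⟩

lemma unique {P Q : Measure (ℤ → ℝ)} (hP : IsUniformProduct P) (hQ : IsUniformProduct Q) :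
    P = Q := by
  have key : ∀ R : Measure (ℤ → ℝ), IsUniformProduct R → R = Measure.infinitePi (fun _ => mu) := by
    intro R hR
    refine Measure.eq_infinitePi (fun _ => mu) ?_
    intro F A hA
    exact hR F A (fun i _ => hA i)
  rw [key P hP, key Q hQ]

lemma measurable_merge (S : Set ℤ) : Measurable (merge S) := by
  refine measurable_pi_lambda _ fun i => ?_
  unfold merge
  by_cases h : i ∈ S <;> simp only [h, if_true, if_false] <;> fun_prop

lemma map_merge {P : Measure (ℤ → ℝ)} (hP : IsUniformProduct P) (S : Set ℤ) :
    (P.prod P).map (merge S) = P := by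
  classical
  have := isProb hP
  refine unique ?_ hP
  intro F A hA
  have hm : MeasurableSet {T : ℤ → ℝ | ∀ i ∈ F, T i ∈ A i} :=
    MeasurableSet.pi F.countable_toSet (t := A) hA
  rw [Measure.map_apply (measurable_merge S) hm]
  have : merge S ⁻¹' {T : ℤ → ℝ | ∀ i ∈ F, T i ∈ A i} =
      {T | ∀ i ∈ F.filter (· ∈ S), T i ∈ A i} ×ˢ {T | ∀ i ∈ F.filter (¬ · ∈ S), T i ∈ A i} := by
    ext ⟨T, T'⟩
    simp only [mem_preimage, mem_ofPred_eq, mem_prod, Finset.mem_filter, merge]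
    constructor
    · intro h
      refine ⟨fun i hi => ?_, fun i hi => ?_⟩
      · simpa [hi.2] using h i hi.1
      · simpa [hi.2] using h i hi.1
    · rintro ⟨h1, h2⟩ i hi
      by_cases hS : i ∈ S
      · simpa [hS] using h1 i ⟨hi, hS⟩
      · simpa [hS] using h2 i ⟨hi, hS⟩
  rw [this, Measure.prod_prod, hP _ A (fun i hi => hA i (Finset.mem_filter.1 hi).1),
    hP _ A (fun i hi => hA i (Finset.mem_filter.1 hi).1), Finset.prod_filter_mul_prod_filter_not]

/-- `A` depends only on the coordinates in `S`. -/
def Dep (S : Set ℤ) (A : Set (ℤ → ℝ)) : Prop :=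
  ∀ T T' : ℤ → ℝ, (∀ i ∈ S, T i = T' i) → (T ∈ A ↔ T' ∈ A)

lemma indep {P : Measure (ℤ → ℝ)} (hP : IsUniformProduct P) (S : Set ℤ) {A B : Set (ℤ → ℝ)}
    (hAm : MeasurableSet A) (hBm : MeasurableSet B) (hA : Dep S A) (hB : Dep Sᶜ B) :
    P.real (A ∩ B) = P.real A * P.real B := by
  have := isProb hP
  have : P (A ∩ B) = P A * P B := by
    conv_lhs => rw [← map_merge hP S]
    rw [Measure.map_apply (measurable_merge S) (hAm.inter hBm), ← Measure.prod_prod]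
    congr 1
    ext ⟨T, T'⟩
    simp only [mem_preimage, mem_inter_iff, mem_prod]
    refine and_congr (hA _ _ ?_) (hB _ _ ?_)
    · intro i hi; simp [merge, hi]
    · intro i hi
      have : i ∉ S := hi
      simp [merge, this]
  simp [Measure.real, this]

lemma map_eval {P : Measure (ℤ → ℝ)} (hP : IsUniformProduct P) (i : ℤ) :
    P.map (fun T => T i) = mu := by
  ext A hA
  rw [Measure.map_apply (measurable_pi_apply i) hA]
  have h := hP {i} (fun _ => A) (fun _ _ => hA)
  simp only [Finset.mem_singleton, forall_eq, Finset.prod_singleton] at h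
  exact h

lemma fubini {P : Measure (ℤ → ℝ)} (hP : IsUniformProduct P) (i : ℤ) {B : Set (ℝ × (ℤ → ℝ))}
    (hB : MeasurableSet B) (hdep : ∀ u, Dep {i}ᶜ {T | (u, T) ∈ B}) :
    P {T | (T i, T) ∈ B} = ∫⁻ u, P {T | (u, T) ∈ B} ∂mu := by
  have := isProb hP
  have hm : Measurable (fun T : ℤ → ℝ => (T i, T)) := by fun_prop
  have hm2 : Measurable (fun p : (ℤ → ℝ) × (ℤ → ℝ) => (p.1 i, p.2)) := by fun_prop
  conv_lhs => rw [← map_merge hP {i}]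
  change ((P.prod P).map (merge {i})) ((fun T : ℤ → ℝ => (T i, T)) ⁻¹' B) = _
  rw [Measure.map_apply (measurable_merge _) (hm hB)]
  have : merge {i} ⁻¹' ((fun T : ℤ → ℝ => (T i, T)) ⁻¹' B) =
      (fun p : (ℤ → ℝ) × (ℤ → ℝ) => (p.1 i, p.2)) ⁻¹' B := by
    ext ⟨T, T'⟩
    have h1 : merge {i} (T, T') i = T i := by simp [merge]
    simp only [mem_preimage, h1]
    refine hdep (T i) _ _ ?_
    intro j hj
    have : j ≠ i := hj
    simp [merge, this]
  rw [this, Measure.prod_apply (hm2 hB), ← map_eval hP i]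
  have hmB : Measurable (fun u => P {T | (u, T) ∈ B}) := measurable_measure_prodMk_left hB
  rw [lintegral_map hmB (measurable_pi_apply i)]
  rfl

lemma fubini_real {P : Measure (ℤ → ℝ)} (hP : IsUniformProduct P) (i : ℤ)
    {B : Set (ℝ × (ℤ → ℝ))}
    (hB : MeasurableSet B) (hdep : ∀ u, Dep {i}ᶜ {T | (u, T) ∈ B}) (f : ℝ → ℝ)
    (hf : ∀ u ∈ Icc (0 : ℝ) 1, P.real {T | (u, T) ∈ B} = f u) {t : ℝ} (ht : t ∈ Icc (0 : ℝ) 1) :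
    P.real {T | T i < t ∧ (T i, T) ∈ B} = ∫ u in (0 : ℝ)..t, f u := by
  have := isProb hP
  have hB' : MeasurableSet (B ∩ {p | p.1 < t}) :=
    hB.inter (measurableSet_lt measurable_fst measurable_const)
  have h := fubini hP i hB' (by
    intro u T T' h
    have := hdep u T T' h
    simp only [mem_ofPred_eq, mem_inter_iff] at this ⊢
    rw [this])
  have e : {T : ℤ → ℝ | T i < t ∧ (T i, T) ∈ B} = {T | (T i, T) ∈ B ∩ {p | p.1 < t}} := by
    ext T; simp [and_comm]
  rw [e, Measure.real, h]
  have hmeas : Measurable (fun u => P {T | (u, T) ∈ B ∩ {p | p.1 < t}}) :=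
    measurable_measure_prodMk_left (ν := P) hB'
  rw [← integral_toReal hmeas.aemeasurable (Filter.Eventually.of_forall fun u => measure_lt_top _ _),
    intervalIntegral.integral_of_le ht.1]
  have : ∀ u ∈ Icc (0 : ℝ) 1, (P {T | (u, T) ∈ B ∩ {p | p.1 < t}}).toReal =
      (Iio t).indicator f u := by
    intro u hu
    by_cases h : u < t
    · rw [indicator_of_mem (by exact h), ← hf u hu]
      simp [h, Measure.real]
    · rw [indicator_of_notMem (by exact h)]
      simp [h]
  rw [setIntegral_congr_fun measurableSet_Icc this, setIntegral_indicator measurableSet_Iio]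
  rw [integral_Ioc_eq_integral_Ioo, ← integral_Ico_eq_integral_Ioo]
  congr 2
  ext u
  have := ht.2
  simp only [mem_inter_iff, mem_Icc, mem_Iio, mem_Ico]
  constructor
  · rintro ⟨⟨a, b⟩, c⟩; exact ⟨a, c⟩
  · rintro ⟨a, c⟩; exact ⟨⟨a, by linarith⟩, c⟩

lemma measure_eq_const {P : Measure (ℤ → ℝ)} (hP : IsUniformProduct P) (i : ℤ) (u : ℝ) :
    P {T | T i = u} = 0 := by
  have := map_eval hP i
  have h2 : P.map (fun T => T i) {u} = 0 := by rw [this]; simp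
  rwa [Measure.map_apply (measurable_pi_apply i) (measurableSet_singleton u)] at h2

lemma ae_ne {P : Measure (ℤ → ℝ)} (hP : IsUniformProduct P) (i j : ℤ) (h : i ≠ j) :
    ∀ᵐ T ∂P, T i ≠ T j := by
  rw [ae_iff]
  have := fubini hP i (B := {p | p.1 = p.2 j})
    (measurableSet_eq_fun measurable_fst (by fun_prop)) (by
      intro u T T' hT
      have := hT j h.symm
      simp [this])
  simp only [mem_ofPred_eq] at this
  simp only [ne_eq, not_not, this]
  rw [lintegral_eq_zero_iff']
  · refine Filter.Eventually.of_forall fun u => ?_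
    simpa [eq_comm] using measure_eq_const hP j u
  · have := isProb hP
    exact (measurable_measure_prodMk_left (ν := P)
      (s := {p : ℝ × (ℤ → ℝ) | p.1 = p.2 j})
      (measurableSet_eq_fun measurable_fst (by fun_prop))).aemeasurable

/-- Decreasing chain in direction `d`, starting below level `u`. -/
def chain (d : ℤ) : ℕ → ℤ → ℝ → (ℤ → ℝ) → Prop
  | 0, _, _, _ => True
  | m + 1, a, u, T => T (a + d) < u ∧ chain d m (a + d) (T (a + d)) T

lemma chain_meas (d : ℤ) (m : ℕ) (a : ℤ) :
    MeasurableSet {p : ℝ × (ℤ → ℝ) | chain d m a p.1 p.2} := by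
  induction m generalizing a with
  | zero => simp [chain]
  | succ m ih =>
    have h1 : MeasurableSet {p : ℝ × (ℤ → ℝ) | p.2 (a + d) < p.1} :=
      measurableSet_lt (by fun_prop) (by fun_prop)
    have h2 : Measurable (fun p : ℝ × (ℤ → ℝ) => (p.2 (a + d), p.2)) := by fun_prop
    exact h1.inter (h2 (ih (a + d)))

lemma chain_dep (d : ℤ) (m : ℕ) (a : ℤ) (u : ℝ) (T T' : ℤ → ℝ)
    (h : ∀ i : ℕ, i < m → T (a + d * (i + 1)) = T' (a + d * (i + 1))) :
    chain d m a u T ↔ chain d m a u T' := by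
  induction m generalizing a u with
  | zero => simp [chain]
  | succ m ih =>
    have h0 := h 0 (by omega)
    simp only [Nat.cast_zero, zero_add, mul_one] at h0
    simp only [chain, h0]
    rw [ih]
    intro i hi
    have := h (i + 1) (by omega)
    push_cast at this
    rw [show a + d + d * ((i : ℤ) + 1) = a + d * (i + 1 + 1) by ring]
    exact this

lemma chain_iff (d : ℤ) (m : ℕ) (a : ℤ) (T : ℤ → ℝ) :
    chain d m a (T a) T ↔ ∀ i : ℕ, i < m → T (a + d * (i + 1)) < T (a + d * i) := by
  induction m generalizing a with
  | zero => simp [chain]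
  | succ m ih =>
    simp only [chain, ih]
    constructor
    · rintro ⟨h0, h⟩ i hi
      rcases i with _ | i
      · simpa using h0
      · have := h i (by omega)
        push_cast
        rw [show a + d * ((i : ℤ) + 1 + 1) = a + d + d * (i + 1) by ring,
          show a + d * ((i : ℤ) + 1) = a + d + d * i by ring]
        exact this
    · intro h
      refine ⟨by simpa using h 0 (by omega), fun i hi => ?_⟩
      have := h (i + 1) (by omega)
      push_cast at this
      rw [show a + d + d * ((i : ℤ) + 1) = a + d * (i + 1 + 1) by ring,
        show a + d + d * (i : ℤ) = a + d * (i + 1) by ring]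
      exact this

lemma chain_mono (d : ℤ) (m : ℕ) (a : ℤ) (u : ℝ) (T : ℤ → ℝ) (h : chain d (m + 1) a u T) :
    chain d m a u T := by
  induction m generalizing a u with
  | zero => simp [chain]
  | succ m ih => exact ⟨h.1, ih _ _ h.2⟩

lemma chain_mono' (d : ℤ) {m n : ℕ} (hmn : m ≤ n) (a : ℤ) (u : ℝ) (T : ℤ → ℝ)
    (h : chain d n a u T) : chain d m a u T := by
  induction n, hmn using Nat.le_induction with
  | base => exact h
  | succ n _ ih => exact ih (chain_mono _ _ _ _ _ h)

lemma chain_prob {P : Measure (ℤ → ℝ)} (hP : IsUniformProduct P) (d : ℤ) (hd : d ≠ 0)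
    (m : ℕ) (a : ℤ) (u : ℝ) (hu : u ∈ Icc (0 : ℝ) 1) :
    P.real {T | chain d m a u T} = u ^ m / m.factorial := by
  have := isProb hP
  induction m generalizing a u with
  | zero => simp [chain]
  | succ m ih =>
    have := fubini_real hP (a + d) (chain_meas d m (a + d)) (by
      intro v T T' h
      refine chain_dep d m _ v T T' fun i hi => h _ ?_
      simp only [mem_compl_iff, mem_singleton_iff]
      intro h0
      have : d * ((i : ℤ) + 1) = 0 := by linarith
      rcases mul_eq_zero.1 this with h | h
      · exact hd h
      · omega) (fun v => v ^ m / m.factorial) (fun v hv => ih (a + d) v hv) hu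
    simp only [mem_ofPred_eq] at this
    simp only [chain, this]
    rw [intervalIntegral.integral_div, integral_pow, Nat.factorial_succ]
    have : (m.factorial : ℝ) ≠ 0 := by positivity
    push_cast
    field_simp
    simp

/-- Chain stops at an even position `2 j` with `j < n`. -/
def E (d : ℤ) (n : ℕ) (a : ℤ) (u : ℝ) : Set (ℤ → ℝ) :=
  {T | ∃ j < n, chain d (2 * j) a u T ∧ ¬ chain d (2 * j + 1) a u T}

/-- Chain stops at an even position. -/
def Einf (d : ℤ) (a : ℤ) (u : ℝ) : Set (ℤ → ℝ) :=
  {T | ∃ j, chain d (2 * j) a u T ∧ ¬ chain d (2 * j + 1) a u T}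

lemma E_meas (d : ℤ) (n : ℕ) (a : ℤ) : MeasurableSet {p : ℝ × (ℤ → ℝ) | p.2 ∈ E d n a p.1} := by
  have : {p : ℝ × (ℤ → ℝ) | p.2 ∈ E d n a p.1} = ⋃ j : ℕ, ⋃ _ : j < n,
      {p : ℝ × (ℤ → ℝ) | chain d (2 * j) a p.1 p.2} ∩
        {p : ℝ × (ℤ → ℝ) | chain d (2 * j + 1) a p.1 p.2}ᶜ := by
    ext p; simp [E, and_left_comm]
  rw [this]
  exact MeasurableSet.iUnion fun j => MeasurableSet.iUnion fun _ =>
    (chain_meas _ _ _).inter (chain_meas _ _ _).compl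

lemma Einf_meas (d : ℤ) (a : ℤ) : MeasurableSet {p : ℝ × (ℤ → ℝ) | p.2 ∈ Einf d a p.1} := by
  have : {p : ℝ × (ℤ → ℝ) | p.2 ∈ Einf d a p.1} = ⋃ j : ℕ, 
      {p : ℝ × (ℤ → ℝ) | chain d (2 * j) a p.1 p.2} ∩
        {p : ℝ × (ℤ → ℝ) | chain d (2 * j + 1) a p.1 p.2}ᶜ := by
    ext p; simp [Einf]
  rw [this]
  exact MeasurableSet.iUnion fun j => 
    (chain_meas _ _ _).inter (chain_meas _ _ _).compl

lemma sec_meas {B : Set (ℝ × (ℤ → ℝ))} (hB : MeasurableSet B) (u : ℝ) :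
    MeasurableSet {T | (u, T) ∈ B} := measurable_prodMk_left hB

lemma E_prob {P : Measure (ℤ → ℝ)} (hP : IsUniformProduct P) (d : ℤ) (hd : d ≠ 0)
    (n : ℕ) (a : ℤ) (u : ℝ) (hu : u ∈ Icc (0 : ℝ) 1) :
    P.real (E d n a u) = ∑ m ∈ Finset.range (2 * n), (-u) ^ m / m.factorial := by
  have := isProb hP
  induction n with
  | zero => simp [E]
  | succ n ih =>
    have e : E d (n + 1) a u = E d n a u ∪
        ({T | chain d (2 * n) a u T} \ {T | chain d (2 * n + 1) a u T}) := by
      ext T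
      simp only [E, mem_ofPred_eq, mem_union, mem_sdiff, Nat.lt_succ_iff_lt_or_eq]
      constructor
      · rintro ⟨j, hj | rfl, h⟩
        · exact Or.inl ⟨j, hj, h⟩
        · exact Or.inr h
      · rintro (⟨j, hj, h⟩ | h)
        · exact ⟨j, Or.inl hj, h⟩
        · exact ⟨n, Or.inr rfl, h⟩
    have hc : ∀ m, MeasurableSet {T | chain d m a u T} := fun m => sec_meas (chain_meas d m a) u
    have hsub : {T | chain d (2 * n + 1) a u T} ⊆ {T | chain d (2 * n) a u T} :=
      fun T h => chain_mono d _ a u T h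
    rw [e, measureReal_union ?_ ((hc _).diff (hc _)), ih,
      measureReal_sdiff hsub (hc _),
      chain_prob hP d hd _ a u hu, chain_prob hP d hd _ a u hu,
      show 2 * (n + 1) = 2 * n + 1 + 1 by ring, Finset.sum_range_succ, Finset.sum_range_succ]
    · rw [pow_succ (-u) (2 * n), pow_mul (-u), neg_sq, ← pow_mul, pow_succ u (2 * n)]
      ring
    · rw [Set.disjoint_left]
      rintro T ⟨j, hj, h⟩ h2
      exact h.2 (chain_mono' d (by omega) a u T h2.1)

lemma Einf_prob {P : Measure (ℤ → ℝ)} (hP : IsUniformProduct P) (d : ℤ) (hd : d ≠ 0)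
    (a : ℤ) (u : ℝ) (hu : u ∈ Icc (0 : ℝ) 1) :
    P.real (Einf d a u) = Real.exp (-u) := by
  have := isProb hP
  have e : Einf d a u = ⋃ n, E d n a u := by
    ext T
    simp only [E, Einf, mem_iUnion, mem_ofPred_eq]
    constructor
    · rintro ⟨j, h⟩; exact ⟨j + 1, j, by omega, h⟩
    · rintro ⟨_, j, _, h⟩; exact ⟨j, h⟩
  have hmono : Monotone (fun n => E d n a u) := by
    rintro m n hmn T ⟨j, hj, h⟩
    exact ⟨j, by omega, h⟩
  have h1 := tendsto_measure_iUnion_atTop (μ := P) hmono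
  rw [← e] at h1
  have h2 := (ENNReal.tendsto_toReal (measure_ne_top P (Einf d a u))).comp h1
  have h3 : Filter.Tendsto (fun n : ℕ => ∑ m ∈ Finset.range (2 * n), (-u) ^ m / m.factorial)
      Filter.atTop (nhds (Real.exp (-u))) := by
    have := (NormedSpace.expSeries_div_hasSum_exp (-u)).tendsto_sum_nat
    rw [← Real.exp_eq_exp_ℝ] at this
    exact this.comp (Filter.tendsto_atTop_mono (fun n => by show n ≤ 2 * n; omega) Filter.tendsto_id)
  refine tendsto_nhds_unique h2 ?_
  refine h3.congr fun n => ?_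
  exact (E_prob hP d hd n a u hu).symm


lemma stop_iff (d : ℤ) (hd : d ≠ 0) (m : ℕ) (a : ℤ) (T : ℤ → ℝ)
    (hT : ∀ i j, i ≠ j → T i ≠ T j) :
    (chain d m a (T a) T ∧ ¬ chain d (m + 1) a (T a) T) ↔
      (∀ i : ℕ, i < m → T (a + d * (i + 1)) < T (a + d * i)) ∧
        T (a + d * m) < T (a + d * (m + 1)) := by
  rw [chain_iff, chain_iff]
  refine and_congr_right fun h => ?_
  have hne : T (a + d * m) ≠ T (a + d * (m + 1)) := by
    apply hT
    intro h
    apply hd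
    linarith
  constructor
  · intro h2
    by_contra h3
    apply h2
    intro i hi
    rcases Nat.lt_succ_iff_lt_or_eq.1 hi with hi | rfl
    · exact h i hi
    · exact lt_of_le_of_ne (not_lt.1 h3) hne.symm
  · intro h2 h3
    exact lt_asymm h2 (h3 m (by omega))

lemma O_iff (t : ℝ) (s : ℤ) (T : ℤ → ℝ) (hT : ∀ i j, i ≠ j → T i ≠ T j) :
    T ∈ O t s ↔ T s < t ∧ T ∈ Einf (-1) s (T s) ∧ T ∈ Einf 1 s (T s) := by
  have key : ∀ j k : ℕ, T ∈ G t s j k ↔ T s < t ∧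
      (chain (-1) (2 * j) s (T s) T ∧ ¬ chain (-1) (2 * j + 1) s (T s) T) ∧
      (chain 1 (2 * k) s (T s) T ∧ ¬ chain 1 (2 * k + 1) s (T s) T) := by
    intro j k
    rw [stop_iff _ (by norm_num) _ _ _ hT, stop_iff _ (by norm_num) _ _ _ hT]
    have e1 : ∀ i : ℤ, s + -1 * i = s - i := fun i => by ring
    have e2 : ∀ i : ℤ, s - (i + 1) = s - i - 1 := fun i => by ring
    have e3 : ∀ i : ℤ, s + (i + 1) = s + i + 1 := fun i => by ring
    simp only [G, mem_ofPred_eq, e1, e2, one_mul, e3, Nat.cast_mul, Nat.cast_ofNat, and_assoc]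
  simp only [O, mem_iUnion, key, Einf, mem_ofPred_eq]
  constructor
  · rintro ⟨j, k, h, h1, h2⟩
    exact ⟨h, ⟨j, h1⟩, ⟨k, h2⟩⟩
  · rintro ⟨h, ⟨j, h1⟩, ⟨k, h2⟩⟩
    exact ⟨j, k, h, h1, h2⟩

lemma chain_last (d : ℤ) (m : ℕ) (a : ℤ) (u : ℝ) (T : ℤ → ℝ) (h : chain d (m + 1) a u T) :
    T (a + d * (m + 1)) < u := by
  induction m generalizing a u with
  | zero => simpa using h.1
  | succ m ih =>
    have := ih _ _ h.2
    push_cast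
    rw [show a + d * ((m : ℤ) + 1 + 1) = a + d + d * (m + 1) by ring]
    exact this.trans h.1

lemma E_dep (d : ℤ) (n : ℕ) (a : ℤ) (u : ℝ) (T T' : ℤ → ℝ)
    (h : ∀ i : ℕ, i + 1 < 2 * n → T (a + d * (i + 1)) = T' (a + d * (i + 1))) :
    T ∈ E d n a u ↔ T' ∈ E d n a u := by
  simp only [E, mem_ofPred_eq]
  refine exists_congr fun j => and_congr_right fun hj => ?_
  rw [chain_dep d (2 * j) a u T T' fun i hi => h i (by omega),
    chain_dep d (2 * j + 1) a u T T' fun i hi => h i (by omega)]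

lemma Einf_dep (d : ℤ) (a : ℤ) (u : ℝ) (T T' : ℤ → ℝ)
    (h : ∀ i : ℕ, T (a + d * (i + 1)) = T' (a + d * (i + 1))) :
    T ∈ Einf d a u ↔ T' ∈ Einf d a u := by
  simp only [Einf, mem_ofPred_eq]
  refine exists_congr fun j => ?_
  rw [chain_dep d (2 * j) a u T T' fun i hi => h i,
    chain_dep d (2 * j + 1) a u T T' fun i hi => h i]

/-- occupied from the left -/
def X (t : ℝ) : Set (ℤ → ℝ) := {T | T (-1) < t ∧ T ∈ Einf (-1) (-1) (T (-1))}

/-- occupation of the site `s = 2n` given that `T 0 > t` -/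
def Y (t : ℝ) (n : ℕ) : Set (ℤ → ℝ) :=
  {T | T (2 * n) < t ∧ T ∈ E (-1) n (2 * n) (T (2 * n)) ∩ Einf 1 (2 * n) (T (2 * n))}

lemma X_meas (t : ℝ) : MeasurableSet (X t) := by
  have h1 : MeasurableSet {T : ℤ → ℝ | T (-1) < t} :=
    measurableSet_lt (by fun_prop) (by fun_prop)
  have h2 : Measurable (fun T : ℤ → ℝ => (T (-1), T)) := by fun_prop
  exact h1.inter (h2 (Einf_meas (-1) (-1)))

lemma Y_meas (t : ℝ) (n : ℕ) : MeasurableSet (Y t n) := by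
  have h1 : MeasurableSet {T : ℤ → ℝ | T (2 * n) < t} :=
    measurableSet_lt (by fun_prop) (by fun_prop)
  have h2 : Measurable (fun T : ℤ → ℝ => (T (2 * n), T)) := by fun_prop
  exact h1.inter ((h2 (E_meas (-1) n (2 * n))).inter (h2 (Einf_meas 1 (2 * n))))

lemma X_prob {P : Measure (ℤ → ℝ)} (hP : IsUniformProduct P) {t : ℝ} (ht : t ∈ Icc (0 : ℝ) 1) :
    P.real (X t) = 1 - Real.exp (-t) := by
  have := fubini_real hP (-1) (Einf_meas (-1) (-1)) (by
    intro u T T' h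
    refine Einf_dep _ _ _ _ _ fun i => h _ ?_
    simp only [mem_compl_iff, mem_singleton_iff]
    omega) (fun u => Real.exp (-u)) (fun u hu => Einf_prob hP (-1) (by norm_num) (-1) u hu) ht
  refine Eq.trans this ?_
  rw [intervalIntegral.integral_comp_neg (fun u => Real.exp u)]
  simp

lemma sum_split (u : ℝ) (n : ℕ) : ∑ m ∈ Finset.range (2 * n), (-u) ^ m / (m.factorial : ℝ) =
    ∑ i ∈ Finset.range n, u ^ (2 * i) / ((2 * i).factorial : ℝ) -
    ∑ i ∈ Finset.range n, u ^ (2 * i + 1) / ((2 * i + 1).factorial : ℝ) := by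
  induction n with
  | zero => simp
  | succ n ih =>
    rw [show 2 * (n + 1) = 2 * n + 1 + 1 by ring, Finset.sum_range_succ, Finset.sum_range_succ, ih,
      Finset.sum_range_succ, Finset.sum_range_succ, pow_succ (-u) (2 * n), pow_mul (-u), neg_sq,
      ← pow_mul, pow_succ u (2 * n)]
    ring

lemma sum_deriv (u : ℝ) (n : ℕ) :
    HasDerivAt (fun u : ℝ => ∑ i ∈ Finset.range n, u ^ (2 * i + 1) / ((2 * i + 1).factorial : ℝ))
      (∑ i ∈ Finset.range n, u ^ (2 * i) / ((2 * i).factorial : ℝ)) u := by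
  refine HasDerivAt.fun_sum fun i _ => ?_
  have := (hasDerivAt_pow (2 * i + 1) u).div_const ((2 * i + 1).factorial : ℝ)
  refine this.congr_deriv ?_
  have h : ((2 * i).factorial : ℝ) ≠ 0 := by positivity
  rw [Nat.factorial_succ]
  push_cast
  field_simp

lemma integral_eq (t : ℝ) (n : ℕ) :
    ∫ u in (0 : ℝ)..t, (∑ m ∈ Finset.range (2 * n), (-u) ^ m / (m.factorial : ℝ)) * Real.exp (-u) =
      Real.exp (-t) * ∑ i ∈ Finset.range n, t ^ (2 * i + 1) / ((2 * i + 1).factorial : ℝ) := by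
  rw [intervalIntegral.integral_eq_sub_of_hasDerivAt (f := fun u => Real.exp (-u) *
    ∑ i ∈ Finset.range n, u ^ (2 * i + 1) / ((2 * i + 1).factorial : ℝ))]
  · simp
  · intro u _
    have h1 : HasDerivAt (fun u : ℝ => Real.exp (-u)) (-Real.exp (-u)) u := by
      simpa using (hasDerivAt_neg u).exp
    refine (h1.mul (sum_deriv u n)).congr_deriv ?_
    rw [sum_split]
    ring
  · apply Continuous.intervalIntegrable
    fun_prop

lemma Y_prob {P : Measure (ℤ → ℝ)} (hP : IsUniformProduct P) {t : ℝ} (ht : t ∈ Icc (0 : ℝ) 1)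
    (n : ℕ) : P.real (Y t n) =
      Real.exp (-t) * ∑ i ∈ Finset.range n, t ^ (2 * i + 1) / ((2 * i + 1).factorial : ℝ) := by
  have := fubini_real hP (2 * n) ((E_meas (-1) n (2 * n)).inter (Einf_meas 1 (2 * n))) (by
    intro u T T' h
    refine and_congr (E_dep _ _ _ _ _ _ fun i hi => h _ ?_) (Einf_dep _ _ _ _ _ fun i => h _ ?_)
    all_goals
      simp only [mem_compl_iff, mem_singleton_iff]
      omega)
    (fun u => (∑ m ∈ Finset.range (2 * n), (-u) ^ m / (m.factorial : ℝ)) * Real.exp (-u))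
    (fun u hu => by
      rw [← E_prob hP (-1) (by norm_num) n (2 * n) u hu,
        ← Einf_prob hP 1 (by norm_num) (2 * n) u hu]
      refine indep hP (Iio (2 * n)) (sec_meas (E_meas (-1) n (2 * n)) u)
        (sec_meas (Einf_meas 1 (2 * n)) u) ?_ ?_
      · intro T T' h
        refine E_dep _ _ _ _ _ _ fun i hi => h _ ?_
        simp only [mem_Iio]
        omega
      · intro T T' h
        refine Einf_dep _ _ _ _ _ fun i => h _ ?_
        simp only [mem_compl_iff, mem_Iio]
        omega) ht
  exact this.trans (integral_eq t n)

lemma X_dep (t : ℝ) : Dep (Iio 0) (X t) := by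
  intro T T' h
  have h0 : T (-1) = T' (-1) := h _ (by simp)
  simp only [X, mem_ofPred_eq, h0]
  refine and_congr_right fun _ => Einf_dep _ _ _ _ _ fun i => h _ ?_
  simp only [mem_Iio]
  omega

lemma Y_dep (t : ℝ) (n : ℕ) (hn : 1 ≤ n) : Dep (Ioi 0) (Y t n) := by
  intro T T' h
  have h0 : T (2 * n) = T' (2 * n) := h _ (by simp only [mem_Ioi]; omega)
  simp only [Y, mem_ofPred_eq, h0]
  refine and_congr_right fun _ => and_congr (E_dep _ _ _ _ _ _ fun i hi => h _ ?_)
    (Einf_dep _ _ _ _ _ fun i => h _ ?_)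
  all_goals
    simp only [mem_Ioi]
    omega

lemma Z_prob {P : Measure (ℤ → ℝ)} (hP : IsUniformProduct P) {t : ℝ} (ht : t ∈ Icc (0 : ℝ) 1) :
    P.real {T | t < T 0} = 1 - t := by
  have h := map_eval hP 0
  have h2 : P.map (fun T => T 0) (Ioi t) = ENNReal.ofReal (1 - t) := by
    rw [h, Measure.restrict_apply measurableSet_Ioi]
    have : Ioi t ∩ Icc 0 1 = Ioc t 1 := by
      ext u
      simp only [mem_inter_iff, mem_Ioi, mem_Icc, mem_Ioc]
      have := ht.1
      constructor
      · rintro ⟨a, b, c⟩; exact ⟨a, c⟩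
      · rintro ⟨a, c⟩; exact ⟨a, by linarith, c⟩
    rw [this, Real.volume_Ioc]
  rw [Measure.map_apply (measurable_pi_apply 0) measurableSet_Ioi] at h2
  have h3 : P {T | t < T 0} = ENNReal.ofReal (1 - t) := h2
  rw [Measure.real, h3, ENNReal.toReal_ofReal (by linarith [ht.2])]

lemma D_iff (t : ℝ) (n : ℕ) (hn : 1 ≤ n) (T : ℤ → ℝ) (hT : ∀ i j, i ≠ j → T i ≠ T j)
    (h0 : t < T 0) : T ∈ D t (2 * n) ↔ T ∉ X t ∧ T ∈ Y t n := by
  have hO0 : T ∉ O t 0 := by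
    rw [O_iff t 0 T hT]
    rintro ⟨h, _⟩
    exact lt_asymm h h0
  have hOm : T ∈ O t (-1) ↔ T ∈ X t := by
    rw [O_iff t (-1) T hT]
    simp only [X, mem_ofPred_eq]
    constructor
    · rintro ⟨a, b, c⟩; exact ⟨a, b⟩
    · rintro ⟨a, b⟩
      refine ⟨a, b, 0, by simp [chain], ?_⟩
      rintro ⟨c, _⟩
      simp only [Int.reduceNeg, neg_add_cancel] at c
      linarith
  have hOs : T ∈ O t (2 * n) ↔ T ∈ Y t n := by
    rw [O_iff t _ T hT]
    simp only [Y, mem_ofPred_eq, mem_inter_iff]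
    refine and_congr_right fun hs => and_congr_left fun _ => ?_
    simp only [E, Einf, mem_ofPred_eq]
    constructor
    · rintro ⟨j, h⟩
      refine ⟨j, ?_, h⟩
      by_contra hj
      have h1 := chain_mono' (-1) (show 2 * n - 1 + 1 ≤ 2 * j by omega) _ _ _ h.1
      have h2 := chain_last _ _ _ _ _ h1
      have e : (2 * n : ℤ) + -1 * (((2 * n - 1 : ℕ) : ℤ) + 1) = 0 := by omega
      rw [e] at h2
      linarith
    · rintro ⟨j, _, h⟩; exact ⟨j, h⟩
  simp only [D, mem_inter_iff, mem_compl_iff, hO0, hOm, hOs, not_false_eq_true, and_true]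

lemma main {P : Measure (ℤ → ℝ)} (hP : IsUniformProduct P) {t : ℝ} (ht : t ∈ Icc (0 : ℝ) 1)
    (n : ℕ) (hn : 1 ≤ n) :
    P.real (D t (2 * n) ∩ M1 t) + P.real (D t (2 * n) ∩ M3 t) =
      Real.exp (-2 * t) * (1 - t) *
        ∑ i ∈ Finset.range n, t ^ (2 * i + 1) / ((2 * i + 1).factorial : ℝ) := by
  have := isProb hP
  have hinj : ∀ᵐ T ∂P, ∀ i j, i ≠ j → T i ≠ T j := by
    simp only [ae_all_iff]
    exact fun i j h => ae_ne hP i j h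
  have hne : ∀ᵐ T ∂P, T (-1) ≠ t := by
    rw [ae_iff]
    simpa using measure_eq_const hP (-1) t
  have hA : MeasurableSet {T : ℤ → ℝ | T (-1) < t} :=
    measurableSet_lt (by fun_prop) (by fun_prop)
  have hZ : MeasurableSet {T : ℤ → ℝ | t < T 0} :=
    measurableSet_lt (by fun_prop) (by fun_prop)
  set W : Set (ℤ → ℝ) := (X t)ᶜ ∩ ({T | t < T 0} ∩ Y t n) with hW
  have h1 : P.real (D t (2 * n) ∩ M1 t) = P.real (W \ {T : ℤ → ℝ | T (-1) < t}) := by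
    refine measureReal_congr ?_
    filter_upwards [hinj, hne] with T hT hT1
    apply propext
    change (T ∈ D t (2 * n) ∧ (t < T (-1) ∧ t < T 0)) ↔
      ((T ∉ X t ∧ (t < T 0 ∧ T ∈ Y t n)) ∧ ¬ T (-1) < t)
    have h3 : ¬ T (-1) < t ↔ t < T (-1) := by
      rw [not_lt]; exact ⟨fun h => lt_of_le_of_ne h hT1.symm, le_of_lt⟩
    rw [h3]
    have := D_iff t n hn T hT
    tauto
  have h2 : P.real (D t (2 * n) ∩ M3 t) = P.real (W ∩ {T : ℤ → ℝ | T (-1) < t}) := by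
    refine measureReal_congr ?_
    filter_upwards [hinj] with T hT
    apply propext
    change (T ∈ D t (2 * n) ∧ (T (-1) < t ∧ t < T 0)) ↔
      ((T ∉ X t ∧ (t < T 0 ∧ T ∈ Y t n)) ∧ T (-1) < t)
    have := D_iff t n hn T hT
    tauto
  have hXc : Dep (Iio 0) (X t)ᶜ := by
    intro T T' h
    exact not_congr (X_dep t T T' h)
  rw [h1, h2, add_comm, measureReal_inter_add_sdiff hA, hW,
    indep hP (Iio 0) (X_meas t).compl (hZ.inter (Y_meas t n)) hXc,
    indep hP {0} hZ (Y_meas t n), probReal_compl_eq_one_sub (X_meas t), X_prob hP ht,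
    Z_prob hP ht, Y_prob hP ht]
  · rw [show -2 * t = -t + -t by ring, Real.exp_add]
    ring
  · intro T T' h
    have := h 0 rfl
    simp [this]
  · intro T T' h
    refine Y_dep t n hn T T' fun i hi => h i ?_
    have : 0 < i := hi
    simp only [mem_compl_iff, mem_singleton_iff]
    omega
  · intro T T' h
    have h0 := h 0 (by simp)
    refine and_congr (by simp [h0]) (Y_dep t n hn T T' fun i hi => h i ?_)
    have : 0 < i := hi
    simp only [mem_compl_iff, mem_Iio]
    omega

end RSA
end

theorem gamma_one_add_three (P : Measure (ℤ → ℝ)) (hP : IsUniformProduct P)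
    (t : ℝ) (ht : t ∈ Icc (0 : ℝ) 1) (s : ℕ) (hs : 2 ≤ s) (hse : Even s) :
    (P (D t s ∩ M1 t)).toReal + (P (D t s ∩ M3 t)).toReal =
      Real.exp (-2 * t) * (1 - t) *
        ∑ i ∈ Finset.range (s / 2), t ^ (2 * i + 1) / (Nat.factorial (2 * i + 1)) := by

  obtain ⟨n, rfl⟩ := hse
  have h := RSA.main hP ht n (by omega)
  rw [show (n + n) / 2 = n by omega, show ((n + n : ℕ) : ℤ) = 2 * n by push_cast; ring]
  exact h
end

section
/- For every t ∈ [0,1] and every even integer s ≥ 2, γ_{s,2}(t) + γ_{s,4}(t) = −e^{−2t} [ (1/2) ∑_{i=3}^{s} (−2t)^i/i! + (1−t) ∑_{i=0}^{s/2−2} t^{2i+3}/(2i+3)! ], where γ_{s,i}(t) := ℙ(D_s(t) ∩ M_i(t)) and the second sum is empty when s = 2. -/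
open MeasureTheory Set

abbrev Om := ℤ → ℝ

noncomputable abbrev U : Measure ℝ := volume.restrict (Icc (0 : ℝ) 1)

instance instU : IsProbabilityMeasure U := ⟨by simp [U]⟩

lemma eq_pi {P : Measure Om} (hP : IsUniformProduct P) :
    P = Measure.infinitePi (fun _ : ℤ => U) := by
  apply Measure.eq_infinitePi
  intro F A hA
  exact hP F A (fun i _ => hA i)

lemma prob {P : Measure Om} (hP : IsUniformProduct P) : IsProbabilityMeasure P := by
  rw [eq_pi hP]; infer_instance

/-- Resampling one coordinate leaves the measure invariant. -/
lemma resample {P : Measure Om} (hP : IsUniformProduct P) (s : ℤ) :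
    Measure.map (fun p : Om × ℝ => Function.update p.1 s p.2) (P.prod U) = P := by
  have := prob hP
  conv_rhs => rw [eq_pi hP]
  apply Measure.eq_infinitePi
  intro F A hA
  rw [Measure.map_apply measurable_update'
    (MeasurableSet.pi F.countable_toSet (fun i _ => hA i))]
  have hset : (fun p : Om × ℝ => Function.update p.1 s p.2) ⁻¹' (Set.pi F A) =
      {T : Om | ∀ i ∈ F.erase s, T i ∈ A i} ×ˢ (if s ∈ F then A s else univ) := by
    ext ⟨T, x⟩
    simp only [mem_preimage, Set.mem_pi, Finset.mem_coe, mem_prod, Set.mem_ofPred_eq, Finset.mem_erase]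
    constructor
    · intro h
      refine ⟨fun i hi => ?_, ?_⟩
      · have := h i hi.2
        rwa [Function.update_of_ne hi.1] at this
      · split_ifs with hs
        · simpa using h s hs
        · trivial
    · rintro ⟨h1, h2⟩ i hi
      by_cases his : i = s
      · subst his
        simpa [hi] using h2
      · rw [Function.update_of_ne his]
        exact h1 i ⟨his, hi⟩
  rw [hset, Measure.prod_prod, hP _ _ (fun i _ => hA i)]
  by_cases hs : s ∈ F
  · rw [if_pos hs, Finset.prod_erase_mul F _ hs]
  · rw [if_neg hs, Finset.erase_eq_of_notMem hs, measure_univ, mul_one]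

lemma fub {P : Measure Om} (hP : IsUniformProduct P) (s : ℤ) {S : Set Om}
    (hS : MeasurableSet S) :
    P S = ∫⁻ x, P {T | Function.update T s x ∈ S} ∂U := by
  have := prob hP
  conv_lhs => rw [← resample hP s]
  rw [Measure.map_apply measurable_update' hS,
    Measure.prod_apply_symm (measurable_update' hS)]
  rfl

lemma lint_pow (c σ : ℝ) (n : ℕ) (hc : 0 ≤ c) (h0 : 0 ≤ σ) (h1 : σ ≤ 1) :
    ∫⁻ x, (if x < σ then ENNReal.ofReal (c * x ^ n) else 0) ∂U =
      ENNReal.ofReal (c * (σ ^ (n + 1) / (n + 1))) := by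
  have e1 : (fun x : ℝ => if x < σ then ENNReal.ofReal (c * x ^ n) else 0) =
      (Iio σ).indicator (fun x => ENNReal.ofReal (c * x ^ n)) := by
    ext x; simp [indicator_apply]
  have e2 : Iio σ ∩ Icc (0:ℝ) 1 = Ico 0 σ := by
    ext x; simp only [mem_inter_iff, mem_Iio, mem_Icc, mem_Ico]
    constructor
    · rintro ⟨a, b, c⟩; exact ⟨b, a⟩
    · rintro ⟨a, b⟩; exact ⟨b, a, by linarith⟩
  rw [e1, lintegral_indicator measurableSet_Iio, Measure.restrict_restrict measurableSet_Iio, e2,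
    restrict_Ico_eq_restrict_Ioc, ← ofReal_integral_eq_lintegral_ofReal]
  · rw [← intervalIntegral.integral_of_le h0, intervalIntegral.integral_const_mul, integral_pow]
    simp
  · apply IntegrableOn.integrable
    rw [← intervalIntegrable_iff_integrableOn_Ioc_of_le h0]
    apply Continuous.intervalIntegrable
    fun_prop
  · refine (ae_restrict_iff' measurableSet_Ioc).2 (ae_of_all _ fun x hx => ?_)
    have := hx.1.le
    simp only [Pi.zero_apply]; positivity

/-- sigma-algebra generated by the coordinates in `S` -/
abbrev mS (S : Set ℤ) : MeasurableSpace Om :=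
  ⨆ i ∈ S, MeasurableSpace.comap (fun T : Om => T i) inferInstance

lemma mS_coord {S : Set ℤ} {i : ℤ} (hi : i ∈ S) : Measurable[mS S] (fun T : Om => T i) := by
  have h : MeasurableSpace.comap (fun T : Om => T i) inferInstance ≤ mS S :=
    le_iSup₂ (f := fun i (_ : i ∈ S) => MeasurableSpace.comap (fun T : Om => T i) inferInstance) i hi
  exact Measurable.mono (comap_measurable _) h le_rfl

lemma mS_le (S : Set ℤ) : mS S ≤ MeasurableSpace.pi :=
  iSup₂_le fun i _ => (measurable_pi_apply i).comap_le

lemma indep {P : Measure Om} (hP : IsUniformProduct P) {S S' : Set ℤ} (h : Disjoint S S')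
    {A B : Set Om} (hA : MeasurableSet[mS S] A) (hB : MeasurableSet[mS S'] B) :
    P (A ∩ B) = P A * P B := by
  have hi : ProbabilityTheory.iIndepFun (fun (i : ℤ) (T : Om) => T i) P := by
    rw [eq_pi hP]
    exact ProbabilityTheory.iIndepFun_infinitePi (X := fun _ x => x) (fun _ => measurable_id)
  have := ProbabilityTheory.indep_iSup_of_disjoint
    (fun i => (measurable_pi_apply i).comap_le) hi h
  exact (ProbabilityTheory.Indep_iff _ _ _).1 this A B hA hB

def desc (d s : ℤ) (n : ℕ) : Set Om :=
  {T | ∀ i : ℕ, i < n → T (s + d * (i + 1)) < T (s + d * i)}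

lemma meas_desc (m : MeasurableSpace Om) (g : Om → Om) (d s : ℤ) (n : ℕ)
    (h : ∀ i : ℕ, i ≤ n → Measurable[m] (fun T => g T (s + d * i))) :
    MeasurableSet[m] {T | g T ∈ desc d s n} := by
  have : {T | g T ∈ desc d s n} =
      ⋂ (i : ℕ) (_ : i < n), {T | g T (s + d * (i + 1)) < g T (s + d * i)} := by
    ext T; simp [desc]
  rw [this]
  refine MeasurableSet.iInter fun i => MeasurableSet.iInter fun hi => ?_
  refine measurableSet_lt ?_ (h i hi.le)
  have := h (i + 1) hi
  push_cast at this
  exact this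

lemma desc_meas (d s : ℤ) (n : ℕ) : MeasurableSet (desc d s n) :=
  meas_desc _ id d s n (fun i _ => measurable_pi_apply _)

lemma desc_upd (d s : ℤ) (hd : d ≠ 0) (n : ℕ) (σ x : ℝ) (T : Om) :
    Function.update (Function.update T (s + d) x) s σ ∈ desc d s (n + 1) ↔
      x < σ ∧ Function.update T (s + d) x ∈ desc d (s + d) n := by
  have key : ∀ i : ℕ, Function.update (Function.update T (s + d) x) s σ (s + d * (i + 1)) =
      Function.update T (s + d) x (s + d + d * i) := by
    intro i
    rw [Function.update_of_ne]
    · congr 1; ring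
    · intro h
      have : d * ((i : ℤ) + 1) = 0 := by linarith
      rcases mul_eq_zero.1 this with h | h
      · exact hd h
      · omega
  simp only [desc, Set.mem_ofPred_eq]
  constructor
  · intro h
    refine ⟨?_, fun i hi => ?_⟩
    · have h0 := h 0 (by omega)
      have k0 := key 0
      simp only [Nat.cast_zero, zero_add, mul_one, mul_zero, add_zero, Function.update_self] at h0 k0
      rw [k0] at h0
      exact h0
    · have h1 := h (i + 1) (by omega)
      have k1 := key (i + 1)
      have k2 := key i
      push_cast at h1 k1 k2
      rw [k1, k2] at h1
      exact h1
  · rintro ⟨hx, h⟩ i hi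
    rcases i with _ | i
    · have k0 := key 0
      simp only [Nat.cast_zero, zero_add, mul_one, mul_zero, add_zero, Function.update_self] at k0 ⊢
      rw [k0]; exact hx
    · have h1 := h i (by omega)
      have k1 := key (i + 1)
      have k2 := key i
      push_cast at h1 k1 k2 ⊢
      rw [k1, k2]; exact h1

lemma chain_prob {P : Measure Om} (hP : IsUniformProduct P) (d : ℤ) (hd : d ≠ 0) (n : ℕ) :
    ∀ (s : ℤ) (σ : ℝ), 0 ≤ σ → σ ≤ 1 →
    P {T | Function.update T s σ ∈ desc d s n} = ENNReal.ofReal (σ ^ n / n.factorial) := by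
  have := prob hP
  induction n with
  | zero => intro s σ _ _; simp [desc]
  | succ n ih =>
    intro s σ h0 h1
    rw [fub hP (s + d) (S := {T | Function.update T s σ ∈ desc d s (n + 1)})
      (measurable_update_left (desc_meas d s (n + 1)))]
    have e : ∀ᵐ x ∂U, P {T | Function.update T (s + d) x ∈
          {T | Function.update T s σ ∈ desc d s (n + 1)}} =
        (if x < σ then ENNReal.ofReal (((n.factorial : ℝ))⁻¹ * x ^ n) else 0) := by
      refine (ae_restrict_iff' measurableSet_Icc).2 (ae_of_all _ fun x hx => ?_)
      simp only [Set.mem_ofPred_eq, desc_upd d s hd]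
      split_ifs with h
      · simp only [h, true_and]
        rw [ih (s + d) x hx.1 hx.2]
        congr 1; field_simp
      · simp [h]
    rw [lintegral_congr_ae e, lint_pow _ _ _ (by positivity) h0 h1]
    congr 1
    rw [Nat.factorial_succ]; push_cast; field_simp

/-- peak event -/
def pk (t : ℝ) (s : ℤ) (a b : ℕ) : Set Om := {T | T s < t} ∩ (desc (-1) s a ∩ desc 1 s b)

lemma pk_meas (t : ℝ) (s : ℤ) (a b : ℕ) : MeasurableSet (pk t s a b) :=
  (measurableSet_lt (measurable_pi_apply s) measurable_const).inter
    ((desc_meas _ _ _).inter (desc_meas _ _ _))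

lemma upd_coord (S : Set ℤ) (s : ℤ) (σ : ℝ) (j : ℤ) (h : j ≠ s → j ∈ S) :
    Measurable[mS S] (fun T : Om => Function.update T s σ j) := by
  by_cases hj : j = s
  · subst hj; simp only [Function.update_self]; exact measurable_const
  · simp only [Function.update_of_ne hj]; exact mS_coord (h hj)

noncomputable def ff (t : ℝ) (a b : ℕ) : ℝ :=
  t ^ (a + b + 1) / (a.factorial * b.factorial * (a + b + 1))

lemma pk_prob {P : Measure Om} (hP : IsUniformProduct P) (t : ℝ) (h0 : 0 ≤ t) (h1 : t ≤ 1)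
    (s : ℤ) (a b : ℕ) : P.real (pk t s a b) = ff t a b := by
  have := prob hP
  have hpos : 0 ≤ ff t a b := by unfold ff; positivity
  rw [Measure.real, ← ENNReal.toReal_ofReal hpos]
  congr 1
  rw [fub hP s (pk_meas t s a b)]
  have e : ∀ᵐ x ∂U, P {T | Function.update T s x ∈ pk t s a b} =
      (if x < t then ENNReal.ofReal (((a.factorial : ℝ) * b.factorial)⁻¹ * x ^ (a + b)) else 0) := by
    refine (ae_restrict_iff' measurableSet_Icc).2 (ae_of_all _ fun x hx => ?_)
    have : {T | Function.update T s x ∈ pk t s a b} =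
      {T | x < t} ∩ ({T | Function.update T s x ∈ desc (-1) s a} ∩
        {T | Function.update T s x ∈ desc 1 s b}) := by
      ext T; simp [pk]
    rw [this]
    split_ifs with h
    · simp only [h, Set.ofPred_true, univ_inter]
      rw [indep hP (S := Iio s) (S' := Ioi s) ?_ ?_ ?_, chain_prob hP _ (by norm_num) _ _ _ hx.1 hx.2,
        chain_prob hP _ (by norm_num) _ _ _ hx.1 hx.2, ← ENNReal.ofReal_mul (by have := hx.1; positivity)]
      · congr 1; rw [pow_add]; field_simp
      · rw [Set.disjoint_left]; intro i hi hi'; simp only [mem_Iio, mem_Ioi] at hi hi'; omega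
      · refine meas_desc _ _ _ _ _ fun i _ => upd_coord _ _ _ _ fun h => ?_
        simp only [mem_Iio]; omega
      · refine meas_desc _ _ _ _ _ fun i _ => upd_coord _ _ _ _ fun h => ?_
        simp only [mem_Ioi]; omega
    · simp [h]
  rw [lintegral_congr_ae e, lint_pow _ _ _ (by positivity) h0 h1]
  congr 1
  unfold ff
  push_cast; field_simp

/-- exact run -/
def ex (d s : ℤ) (n : ℕ) : Set Om :=
  desc d s n ∩ {T | T (s + d * n) < T (s + d * (n + 1))}

structure Good (T : Om) : Prop where
  ties : ∀ i : ℤ, T i ≠ T (i + 1)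
  fin : ∀ d : ℤ, (d = 1 ∨ d = -1) → ∀ s, ∃ n, T ∉ desc d s n

def Run (d s : ℤ) (T : Om) : Prop := ∃ j : ℕ, T ∈ ex d s (2 * j)

lemma mem_ex (d s : ℤ) (n : ℕ) (T : Om) :
    T ∈ ex d s n ↔ T ∈ desc d s n ∧ T (s + d * n) < T (s + d * (n + 1)) := Iff.rfl

lemma mem_desc (d s : ℤ) (n : ℕ) (T : Om) :
    T ∈ desc d s n ↔ ∀ i : ℕ, i < n → T (s + d * (i + 1)) < T (s + d * i) := Iff.rfl

lemma desc_succ (d s : ℤ) (n : ℕ) (T : Om) :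
    T ∈ desc d s (n + 1) ↔ T ∈ desc d s n ∧ T (s + d * (n + 1)) < T (s + d * n) := by
  rw [mem_desc, mem_desc]
  constructor
  · intro h; exact ⟨fun i hi => h i (by omega), h n (by omega)⟩
  · rintro ⟨h1, h2⟩ i hi
    rcases Nat.lt_succ_iff_lt_or_eq.1 hi with h | h
    · exact h1 i h
    · subst h; exact h2

lemma desc_cons (d s : ℤ) (n : ℕ) (T : Om) :
    T ∈ desc d s (n + 1) ↔ T (s + d) < T s ∧ T ∈ desc d (s + d) n := by
  induction n with
  | zero => rw [desc_succ]; simp [mem_desc]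
  | succ n ih =>
    rw [desc_succ, ih, desc_succ d (s + d) n]
    have e1 : s + d * (((n + 1 : ℕ) : ℤ) + 1) = s + d + d * (n + 1) := by push_cast; ring
    have e2 : s + d * ((n + 1 : ℕ) : ℤ) = s + d + d * n := by push_cast; ring
    rw [e1, e2]; tauto

lemma ex_cons (d s : ℤ) (n : ℕ) (T : Om) :
    T ∈ ex d s (n + 1) ↔ T (s + d) < T s ∧ T ∈ ex d (s + d) n := by
  rw [mem_ex, mem_ex, desc_cons]
  have e1 : s + d * (((n + 1 : ℕ) : ℤ) + 1) = s + d + d * (n + 1) := by push_cast; ring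
  have e2 : s + d * ((n + 1 : ℕ) : ℤ) = s + d + d * n := by push_cast; ring
  rw [e1, e2]; tauto

lemma ex_uniq {d s : ℤ} {n m : ℕ} {T : Om} (h1 : T ∈ ex d s n) (h2 : T ∈ ex d s m) : n = m := by
  rcases lt_trichotomy n m with h | h | h
  · exact absurd h1.2 (not_lt.2 (h2.1 n h).le)
  · exact h
  · exact absurd h2.2 (not_lt.2 (h1.1 m h).le)

lemma ex_drop {d s : ℤ} {n m : ℕ} {T : Om} (h : T ∈ ex d s (n + m)) : T ∈ ex d (s + d * n) m := by
  induction n generalizing s with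
  | zero => simpa using h
  | succ n ih =>
    rw [show n + 1 + m = (n + m) + 1 by ring, ex_cons] at h
    have := ih h.2
    rwa [show s + d * ((n + 1 : ℕ) : ℤ) = s + d + d * n by push_cast; ring]

lemma Good.ne {T : Om} (hT : Good T) {d : ℤ} (hd : d = 1 ∨ d = -1) (i : ℤ) : T i ≠ T (i + d) := by
  rcases hd with rfl | rfl
  · exact hT.ties i
  · have := hT.ties (i + -1)
    simp only [neg_add_cancel_right] at this
    exact this.symm

lemma ex_iff {T : Om} (hT : Good T) {d : ℤ} (hd : d = 1 ∨ d = -1) (s : ℤ) (n : ℕ) :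
    T ∈ ex d s n ↔ T ∈ desc d s n ∧ T ∉ desc d s (n + 1) := by
  rw [mem_ex, desc_succ]
  have := hT.ne hd (s + d * n)
  rw [show s + d * (n:ℤ) + d = s + d * (n + 1) by ring] at this
  constructor
  · rintro ⟨h1, h2⟩; exact ⟨h1, fun h => lt_asymm h2 h.2⟩
  · rintro ⟨h1, h2⟩
    refine ⟨h1, lt_of_le_of_ne ?_ this⟩
    by_contra h
    exact h2 ⟨h1, not_le.1 h⟩

lemma ex_exists {T : Om} (hT : Good T) {d : ℤ} (hd : d = 1 ∨ d = -1) (s : ℤ) :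
    ∃ n, T ∈ ex d s n := by
  classical
  have h := hT.fin d hd s
  have h1 := Nat.find_spec h
  have hpos : Nat.find h ≠ 0 := by
    intro h0; rw [h0] at h1; exact h1 (by simp [mem_desc])
  obtain ⟨n, hn⟩ := Nat.exists_eq_succ_of_ne_zero hpos
  refine ⟨n, (ex_iff hT hd s n).2 ⟨?_, ?_⟩⟩
  · by_contra hc
    exact Nat.find_min h (by omega) hc
  · rw [hn] at h1; exact h1

lemma run_iff {T : Om} (hT : Good T) {d : ℤ} (hd : d = 1 ∨ d = -1) (s : ℤ) :
    Run d s T ↔ ¬ (T (s + d) < T s ∧ Run d (s + d) T) := by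
  constructor
  · rintro ⟨j, hj⟩ ⟨h1, k, hk⟩
    have := ex_uniq hj ((ex_cons d s (2 * k) T).2 ⟨h1, hk⟩)
    omega
  · intro h
    obtain ⟨n, hn⟩ := ex_exists hT hd s
    rcases Nat.even_or_odd' n with ⟨k, rfl | rfl⟩
    · exact ⟨k, hn⟩
    · rw [ex_cons] at hn
      exact absurd ⟨hn.1, k, hn.2⟩ h

lemma mem_O (t : ℝ) (s : ℤ) (T : Om) :
    T ∈ O t s ↔ T s < t ∧ Run (-1) s T ∧ Run 1 s T := by
  have hG : ∀ j k : ℕ, T ∈ G t s j k ↔ T s < t ∧ T ∈ ex (-1) s (2 * j) ∧ T ∈ ex 1 s (2 * k) := by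
    intro j k
    have a1 : ∀ i : ℕ, s + -1 * ((i : ℤ) + 1) = s - i - 1 := fun i => by ring
    have a2 : ∀ i : ℕ, s + -1 * (i : ℤ) = s - i := fun i => by ring
    have a3 : ∀ i : ℕ, s + 1 * ((i : ℤ) + 1) = s + i + 1 := fun i => by ring
    have a4 : ∀ i : ℕ, s + 1 * (i : ℤ) = s + i := fun i => by ring
    simp only [mem_ex, mem_desc, a1, a2, a3, a4, G, Set.mem_ofPred_eq]
    push_cast
    tauto
  simp only [O, mem_iUnion, hG, Run]
  constructor
  · rintro ⟨j, k, h1, h2, h3⟩; exact ⟨h1, ⟨j, h2⟩, ⟨k, h3⟩⟩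
  · rintro ⟨h1, ⟨j, h2⟩, ⟨k, h3⟩⟩; exact ⟨j, k, h1, h2, h3⟩

def EA (t : ℝ) : Set Om := {T | T (-1) < t ∧ Run (-1) (-1) T}ᶜ
def EB (t : ℝ) (k : ℕ) : Set Om := {T | T 0 < t} ∩ ex 1 0 (2 * k + 1)
def EC (t : ℝ) (s : ℤ) (j : ℕ) : Set Om := {T | T s < t} ∩ (ex (-1) s (2 * j) ∩ {T | Run 1 s T})

lemma vacant_iff {T : Om} (hT : Good T) (t : ℝ) (h0 : T 0 < t) :
    (T ∉ O t (-1) ∧ T ∉ O t 0) ↔ (T ∈ EA t ∧ T 1 < T 0 ∧ Run 1 1 T) := by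
  rw [mem_O, mem_O]
  have r0 := run_iff hT (Or.inl rfl) 0
  have r1 := run_iff hT (Or.inl rfl) (-1)
  have l0 := run_iff hT (Or.inr rfl) 0
  norm_num at r0 r1 l0
  simp only [EA, Set.mem_compl_iff, Set.mem_ofPred_eq]
  constructor
  · rintro ⟨h1, h2⟩
    by_cases hR : Run 1 0 T
    · exfalso
      have hL : ¬ Run (-1) 0 T := fun h => h2 ⟨h0, h, hR⟩
      rw [l0] at hL
      push Not at hL
      exact h1 ⟨hL.1.trans h0, hL.2, r1.2 fun h => absurd hL.1 (not_lt.2 h.le)⟩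
    · refine ⟨fun h => h1 ⟨h.1, h.2, r1.2 fun _ => hR⟩, ?_⟩
      rw [r0] at hR
      push Not at hR
      exact hR
  · rintro ⟨h1, h2, h3⟩
    exact ⟨fun h => h1 ⟨h.1, h.2.1⟩, fun h => r0.1 h.2.2 h2 h3⟩

lemma event_iff {T : Om} (hT : Good T) (t : ℝ) (m : ℕ) :
    (T 0 < t ∧ T ∉ O t (-1) ∧ T ∉ O t 0 ∧ T ∈ O t ((2 * m : ℕ) : ℤ)) ↔
      ∃ k j : ℕ, k + j + 2 ≤ m ∧ T ∈ EA t ∩ (EB t k ∩ EC t ((2 * m : ℕ) : ℤ) j) := by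
  constructor
  · rintro ⟨h0, h1, h2, h3⟩
    obtain ⟨hA, h10, k, hk⟩ := (vacant_iff hT t h0).1 ⟨h1, h2⟩
    obtain ⟨hs, ⟨j, hj⟩, ⟨k', hk'⟩⟩ := (mem_O _ _ _).1 h3
    have hB : T ∈ ex 1 0 (2 * k + 1) := (ex_cons 1 0 (2 * k) T).2 (by simpa using ⟨h10, hk⟩)
    refine ⟨k, j, ?_, hA, ⟨h0, hB⟩, hs, hj, ⟨k', hk'⟩⟩
    by_contra hcon
    by_cases hkm : m ≤ k
    · obtain ⟨c, rfl⟩ := Nat.exists_eq_add_of_le hkm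
      rw [show 2 * (m + c) + 1 = 2 * m + (2 * c + 1) by ring] at hB
      have := ex_drop hB
      rw [zero_add, one_mul] at this
      have := ex_uniq this hk'
      omega
    · obtain ⟨c, rfl⟩ : ∃ c, m = k + 1 + c := ⟨m - k - 1, by omega⟩
      by_cases hjc : j = c
      · subst hjc
        have e1 := hB.2
        have e2 := hj.2
        simp only [Set.mem_ofPred_eq] at e1 e2
        push_cast at e1 e2
        ring_nf at e1 e2
        exact lt_asymm e1 e2
      · have e1 := hB.1 (2 * k) (by omega)
        have e2 := hj.1 (2 * c + 1) (by omega)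
        push_cast at e1 e2
        ring_nf at e1 e2
        exact lt_asymm e1 e2
  · rintro ⟨k, j, _, hA, ⟨h0, hB⟩, hs, hj, hR⟩
    have hB' := (ex_cons 1 0 (2 * k) T).1 hB
    simp only [zero_add] at hB'
    obtain ⟨h1, h2⟩ := (vacant_iff hT t h0).2 ⟨hA, hB'.1, k, hB'.2⟩
    exact ⟨h0, h1, h2, (mem_O _ _ _).2 ⟨hs, ⟨j, hj⟩, hR⟩⟩

lemma coord_ae {P : Measure Om} (hP : IsUniformProduct P) (i : ℤ) (x : ℝ) :
    P {T | T i = x} = 0 := by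
  have := hP {i} (fun _ => {x}) (fun _ _ => measurableSet_singleton x)
  simpa using this

lemma ae_good {P : Measure Om} (hP : IsUniformProduct P) : ∀ᵐ T ∂P, Good T := by
  have := prob hP
  have h1 : ∀ᵐ T ∂P, ∀ i : ℤ, T i ≠ T (i + 1) := by
    rw [ae_all_iff]
    intro i
    rw [ae_iff]
    simp only [not_not, ne_eq]
    rw [fub hP i (S := {T | T i = T (i + 1)})
      (measurableSet_eq_fun (measurable_pi_apply _) (measurable_pi_apply _))]
    have : ∀ x : ℝ, P {T | Function.update T i x ∈ {T : Om | T i = T (i + 1)}} = 0 := by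
      intro x
      rw [← coord_ae hP (i + 1) x]
      congr 1
      ext T
      simp [eq_comm]
    rw [lintegral_congr this]; simp
  have h2 : ∀ d : ℤ, d ≠ 0 → ∀ᵐ T ∂P, ∀ s, ∃ n, T ∉ desc d s n := by
    intro d hd
    rw [ae_all_iff]
    intro s
    rw [ae_iff]
    have hb : ∀ n, P (desc d s n) ≤ ENNReal.ofReal (1 / n.factorial) := by
      intro n
      rw [fub hP s (desc_meas d s n)]
      calc _ ≤ ∫⁻ x, ENNReal.ofReal (1 / n.factorial) ∂U := by
            refine lintegral_mono_ae ?_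
            refine (ae_restrict_iff' measurableSet_Icc).2 (ae_of_all _ fun x hx => ?_)
            rw [chain_prob hP d hd n s x hx.1 hx.2]
            apply ENNReal.ofReal_le_ofReal
            gcongr
            exact pow_le_one₀ hx.1 hx.2
        _ = _ := by simp
    have hlim : Filter.Tendsto (fun n : ℕ => ENNReal.ofReal (1 / n.factorial)) Filter.atTop
        (nhds 0) := by
      have := FloorSemiring.tendsto_pow_div_factorial_atTop (1 : ℝ)
      simp only [one_pow] at this
      simpa using ENNReal.tendsto_ofReal this
    refine le_antisymm (ge_of_tendsto hlim (Filter.Eventually.of_forall fun n => ?_)) (zero_le)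
    refine (measure_mono fun T hT => ?_).trans (hb n)
    simp only [not_exists, not_not, Set.mem_ofPred_eq] at hT
    exact hT n
  filter_upwards [h1, h2 1 (by norm_num), h2 (-1) (by norm_num)] with T a b c
  refine ⟨a, ?_⟩
  rintro d (rfl | rfl)
  · exact b
  · exact c

lemma ex_mS (S : Set ℤ) (d s : ℤ) (n : ℕ) (h : ∀ i : ℕ, i ≤ n + 1 → s + d * i ∈ S) :
    MeasurableSet[mS S] (ex d s n) := by
  refine @MeasurableSet.inter _ (mS S) _ _ (meas_desc _ id d s n fun i hi => mS_coord (h i (by omega))) ?_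
  refine measurableSet_lt (mS_coord (h n (by omega))) (mS_coord ?_)
  have := h (n + 1) le_rfl
  push_cast at this
  exact this

lemma run_mS (S : Set ℤ) (d s : ℤ) (h : ∀ i : ℕ, s + d * i ∈ S) :
    MeasurableSet[mS S] {T | Run d s T} := by
  have : {T | Run d s T} = ⋃ j : ℕ, ex d s (2 * j) := by ext T; simp [Run]
  rw [this]
  exact MeasurableSet.iUnion fun j => ex_mS S d s _ fun i _ => h i

lemma lt_mS (S : Set ℤ) (s : ℤ) (t : ℝ) (h : s ∈ S) : MeasurableSet[mS S] {T : Om | T s < t} :=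
  measurableSet_lt (mS_coord h) measurable_const

lemma EA_mS (t : ℝ) : MeasurableSet[mS (Iio 0)] (EA t) := by
  refine @MeasurableSet.compl _ _ (mS _) ?_
  refine @MeasurableSet.inter _ (mS _) _ _ (lt_mS _ _ _ (by simp)) (run_mS _ _ _ fun i => ?_)
  simp only [mem_Iio]; omega

lemma EB_mS (S : Set ℤ) (t : ℝ) (k : ℕ) (h : ∀ i : ℕ, i ≤ 2 * k + 2 → (i : ℤ) ∈ S) :
    MeasurableSet[mS S] (EB t k) := by
  refine @MeasurableSet.inter _ (mS _) _ _ (lt_mS _ _ _ (by simpa using h 0 (by omega)))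
    (ex_mS _ _ _ _ fun i hi => ?_)
  have := h i (by omega)
  simpa using this

lemma EC_mS (S : Set ℤ) (t : ℝ) (s : ℤ) (j : ℕ) (h : ∀ i : ℤ, s - 2 * j - 1 ≤ i → i ∈ S) :
    MeasurableSet[mS S] (EC t s j) := by
  refine @MeasurableSet.inter _ (mS _) _ _ (lt_mS _ _ _ (h _ (by omega)))
    (@MeasurableSet.inter _ (mS _) _ _ (ex_mS _ _ _ _ fun i hi => h _ (by omega))
      (run_mS _ _ _ fun i => h _ (by omega)))

lemma triple {P : Measure Om} (hP : IsUniformProduct P) (t : ℝ) (m k j : ℕ) (h : k + j + 2 ≤ m) :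
    P.real (EA t ∩ (EB t k ∩ EC t ((2 * m : ℕ) : ℤ) j)) =
      P.real (EA t) * (P.real (EB t k) * P.real (EC t ((2 * m : ℕ) : ℤ) j)) := by
  simp only [Measure.real]
  rw [indep hP (S := Iio 0) (S' := Ici 0) ?_ (EA_mS t) ?_,
    indep hP (S := Iic (2 * k + 2)) (S' := Ioi (2 * k + 2)) ?_ (EB_mS _ _ _ ?_) (EC_mS _ _ _ _ ?_)]
  · simp
  · rw [Set.disjoint_left]; intro i hi hi'; simp only [mem_Iic, mem_Ioi] at hi hi'; omega
  · intro i hi; simp only [mem_Iic]; omega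
  · intro i hi; simp only [mem_Ioi]; push_cast at hi; omega
  · rw [Set.disjoint_left]; intro i hi hi'; simp only [mem_Iio, mem_Ici] at hi hi'; omega
  · refine @MeasurableSet.inter _ (mS _) _ _ (EB_mS _ _ _ ?_) (EC_mS _ _ _ _ ?_)
    · intro i hi; simp only [mem_Ici]; omega
    · intro i hi; simp only [mem_Ici]; push_cast at hi; omega

lemma ex_meas (d s : ℤ) (n : ℕ) : MeasurableSet (ex d s n) :=
  mS_le univ _ (ex_mS univ d s n fun _ _ => trivial)

lemma lt_meas (s : ℤ) (t : ℝ) : MeasurableSet {T : Om | T s < t} :=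
  mS_le univ _ (lt_mS univ s t trivial)

lemma union_prob {P : Measure Om} [IsProbabilityMeasure P] (f : ℕ → Set Om)
    (hd : Pairwise (Function.onFun Disjoint f)) (hm : ∀ i, MeasurableSet (f i)) (L : ℝ)
    (hL : Filter.Tendsto (fun K => ∑ k ∈ Finset.range K, P.real (f k)) Filter.atTop (nhds L)) :
    P.real (⋃ k, f k) = L := by
  have h1 := (hasSum_iff_tendsto_nat_of_nonneg (fun i => measureReal_nonneg) L).2 hL
  rw [← h1.tsum_eq, Measure.real, measure_iUnion hd hm, ENNReal.tsum_toReal_eq]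
  · rfl
  · intro i; exact measure_ne_top _ _

/-- left exact -/
def PX (t : ℝ) (s : ℤ) (a b : ℕ) : Set Om := {T | T s < t} ∩ (ex (-1) s a ∩ desc 1 s b)

def PXX (t : ℝ) (s : ℤ) (a b : ℕ) : Set Om := {T | T s < t} ∩ (ex (-1) s a ∩ ex 1 s b)

lemma PX_meas (t : ℝ) (s : ℤ) (a b : ℕ) : MeasurableSet (PX t s a b) :=
  (lt_meas s t).inter ((ex_meas _ _ _).inter (desc_meas _ _ _))

lemma PXX_meas (t : ℝ) (s : ℤ) (a b : ℕ) : MeasurableSet (PXX t s a b) :=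
  (lt_meas s t).inter ((ex_meas _ _ _).inter (ex_meas _ _ _))

lemma desc_anti (d s : ℤ) (n : ℕ) : desc d s (n + 1) ⊆ desc d s n :=
  fun T hT => ((desc_succ d s n T).1 hT).1

lemma diff_prob {P : Measure Om} (hP : IsUniformProduct P) (A B C : Set Om)
    (hBC : C ⊆ B) (hC : MeasurableSet C) (h : ∀ T, Good T → (T ∈ A ↔ T ∈ B ∧ T ∉ C)) :
    P.real A = P.real B - P.real C := by
  have := prob hP
  rw [← measureReal_sdiff hBC hC]
  apply measureReal_congr
  filter_upwards [ae_good hP] with T hT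
  exact propext (h T hT)

lemma PX_prob {P : Measure Om} (hP : IsUniformProduct P) (t : ℝ) (h0 : 0 ≤ t) (h1 : t ≤ 1)
    (s : ℤ) (a b : ℕ) : P.real (PX t s a b) = ff t a b - ff t (a + 1) b := by
  rw [← pk_prob hP t h0 h1 s, ← pk_prob hP t h0 h1 s]
  apply diff_prob hP _ _ _ _ (pk_meas _ _ _ _)
  · intro T hT
    have := ex_iff hT (Or.inr rfl) s a
    simp only [PX, pk, mem_inter_iff, this]; tauto
  · exact fun T hT => ⟨hT.1, desc_anti _ _ _ hT.2.1, hT.2.2⟩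

lemma PXX_prob {P : Measure Om} (hP : IsUniformProduct P) (t : ℝ) (h0 : 0 ≤ t) (h1 : t ≤ 1)
    (s : ℤ) (a b : ℕ) : P.real (PXX t s a b) =
      (ff t a b - ff t (a + 1) b) - (ff t a (b + 1) - ff t (a + 1) (b + 1)) := by
  rw [← PX_prob hP t h0 h1 s, ← PX_prob hP t h0 h1 s]
  apply diff_prob hP _ _ _ _ (PX_meas _ _ _ _)
  · intro T hT
    have := ex_iff hT (Or.inl rfl) s b
    simp only [PX, PXX, mem_inter_iff, this]; tauto
  · exact fun T hT => ⟨hT.1, hT.2.1, desc_anti _ _ _ hT.2.2⟩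

lemma EB_prob {P : Measure Om} (hP : IsUniformProduct P) (t : ℝ) (h0 : 0 ≤ t) (h1 : t ≤ 1)
    (k : ℕ) : P.real (EB t k) =
      t ^ (2 * k + 2) / (2 * k + 2).factorial - t ^ (2 * k + 3) / (2 * k + 3).factorial := by
  have : P.real (EB t k) = P.real (pk t 0 0 (2 * k + 1)) - P.real (pk t 0 0 (2 * k + 2)) := by
    apply diff_prob hP _ _ _ _ (pk_meas _ _ _ _)
    · intro T hT
      have := ex_iff hT (Or.inl rfl) 0 (2 * k + 1)
      have h2 : T ∈ desc (-1) 0 0 := by simp [mem_desc]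
      simp only [EB, pk, mem_inter_iff, this, h2]; tauto
    · exact fun T hT => ⟨hT.1, hT.2.1, desc_anti _ _ _ hT.2.2⟩
  rw [this, pk_prob hP t h0 h1, pk_prob hP t h0 h1]
  simp only [ff]
  rw [Nat.factorial_succ (2 * k + 2), Nat.factorial_succ (2 * k + 1)]
  push_cast
  congr 1 <;> field_simp <;> ring

lemma exp_tendsto (t : ℝ) : Filter.Tendsto
    (fun K => ∑ i ∈ Finset.range K, (-t) ^ i / (i.factorial : ℝ)) Filter.atTop
      (nhds (Real.exp (-t))) := by
  have := (NormedSpace.expSeries_div_hasSum_exp (-t)).tendsto_sum_nat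
  rwa [← Real.exp_eq_exp_ℝ] at this

lemma EA_prob {P : Measure Om} (hP : IsUniformProduct P) (t : ℝ) (h0 : 0 ≤ t) (h1 : t ≤ 1) :
    P.real (EA t) = Real.exp (-t) := by
  have := prob hP
  have e : {T : Om | T (-1) < t ∧ Run (-1) (-1) T} = ⋃ j : ℕ, PX t (-1) (2 * j) 0 := by
    ext T
    have h2 : T ∈ desc 1 (-1) 0 := by simp [mem_desc]
    simp only [PX, mem_iUnion, mem_inter_iff, h2, Set.mem_ofPred_eq, Run]
    constructor
    · rintro ⟨a, j, b⟩; exact ⟨j, a, b, trivial⟩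
    · rintro ⟨j, a, b, _⟩; exact ⟨a, j, b⟩
  rw [EA, e, probReal_compl_eq_one_sub (MeasurableSet.iUnion fun j => PX_meas _ _ _ _),
    union_prob (L := 1 - Real.exp (-t))]
  · ring
  · intro i j hij
    rw [Function.onFun, Set.disjoint_left]
    intro T hi hj
    have := ex_uniq hi.2.1 hj.2.1
    omega
  · exact fun i => PX_meas _ _ _ _
  · have hsum : ∀ K : ℕ, ∑ k ∈ Finset.range K, P.real (PX t (-1) (2 * k) 0) =
        1 - ∑ i ∈ Finset.range (2 * K + 1), (-t) ^ i / (i.factorial : ℝ) := by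
      intro K
      induction K with
      | zero => simp
      | succ K ih =>
        rw [Finset.sum_range_succ, ih, PX_prob hP t h0 h1,
          show 2 * (K + 1) + 1 = 2 * K + 1 + 1 + 1 by ring, Finset.sum_range_succ _ (2 * K + 1 + 1),
          Finset.sum_range_succ _ (2 * K + 1)]
        have p1 : (-t) ^ (2 * K + 1) = - t ^ (2 * K + 1) := Odd.neg_pow ⟨K, rfl⟩ t
        have p2 : (-t) ^ (2 * K + 1 + 1) = t ^ (2 * K + 1 + 1) := Even.neg_pow ⟨K + 1, by ring⟩ t
        rw [p1, p2]
        simp only [ff, Nat.factorial_succ (2 * K + 1), Nat.factorial_succ (2 * K)]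
        push_cast
        field_simp
        ring
    simp only [hsum]
    refine Filter.Tendsto.sub tendsto_const_nhds ((exp_tendsto t).comp ?_)
    exact Filter.tendsto_atTop_mono (fun K => by simp only [id]; omega) Filter.tendsto_id

lemma ff_pascal (t : ℝ) (a b : ℕ) : ff t (a + 1) b + ff t a (b + 1) =
    t ^ (a + 1) / (a + 1).factorial * (t ^ (b + 1) / (b + 1).factorial) := by
  simp only [ff, Nat.factorial_succ]
  push_cast
  field_simp
  ring

lemma EC_prob {P : Measure Om} (hP : IsUniformProduct P) (t : ℝ) (h0 : 0 ≤ t) (h1 : t ≤ 1)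
    (s : ℤ) (j : ℕ) :
    P.real (EC t s j) = Real.exp (-t) * (t ^ (2 * j + 1) / (2 * j + 1).factorial) := by
  have := prob hP
  have e : EC t s j = ⋃ k : ℕ, PXX t s (2 * j) (2 * k) := by
    ext T
    simp only [EC, PXX, mem_iUnion, mem_inter_iff, Set.mem_ofPred_eq, Run]
    constructor
    · rintro ⟨a, b, k, c⟩; exact ⟨k, a, b, c⟩
    · rintro ⟨k, a, b, c⟩; exact ⟨a, b, k, c⟩
  rw [e, union_prob]
  · intro i j hij
    rw [Function.onFun, Set.disjoint_left]
    intro T hi hj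
    have := ex_uniq hi.2.2 hj.2.2
    omega
  · exact fun i => PXX_meas _ _ _ _
  · set c := t ^ (2 * j + 1) / ((2 * j + 1).factorial : ℝ) with hc
    have hsum : ∀ K : ℕ, ∑ k ∈ Finset.range K, P.real (PXX t s (2 * j) (2 * k)) =
        (∑ i ∈ Finset.range (2 * K), (-t) ^ i / (i.factorial : ℝ)) * c
          - (ff t (2 * j) (2 * K) - c * (t ^ (2 * K) / (2 * K).factorial)) := by
      intro K
      induction K with
      | zero =>
        simp [ff, hc, Nat.factorial_succ]; field_simp; ring
      | succ K ih =>
        rw [Finset.sum_range_succ, ih, PXX_prob hP t h0 h1,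
          show 2 * (K + 1) = 2 * K + 1 + 1 by ring, Finset.sum_range_succ _ (2 * K + 1),
          Finset.sum_range_succ _ (2 * K)]
        have p1 : (-t) ^ (2 * K + 1) = - t ^ (2 * K + 1) := Odd.neg_pow ⟨K, rfl⟩ t
        have p2 : (-t) ^ (2 * K) = t ^ (2 * K) := Even.neg_pow ⟨K, by ring⟩ t
        rw [p1, p2]
        have q1 := ff_pascal t (2 * j) (2 * K)
        have q2 := ff_pascal t (2 * j) (2 * K + 1)
        rw [← hc] at q1 q2
        linear_combination q2 - q1
    simp only [hsum]
    have hE : Filter.Tendsto (fun K : ℕ => 2 * K) Filter.atTop Filter.atTop :=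
      Filter.tendsto_atTop_mono (fun K => by simp only [id]; omega) Filter.tendsto_id
    have hz : Filter.Tendsto (fun K : ℕ => c * (t ^ (2 * K) / ((2 * K).factorial : ℝ)))
        Filter.atTop (nhds 0) := by
      have := ((FloorSemiring.tendsto_pow_div_factorial_atTop t).comp hE).const_mul c
      simpa using this
    have hf : Filter.Tendsto (fun K : ℕ => ff t (2 * j) (2 * K)) Filter.atTop (nhds 0) := by
      refine squeeze_zero (fun K => by unfold ff; positivity) (fun K => ?_) hz
      have : ff t (2 * j) (2 * K) = c * (t ^ (2 * K) / ((2 * K).factorial : ℝ)) *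
          ((2 * j + 1) / (2 * j + 2 * K + 1)) := by
        simp only [ff, hc, Nat.factorial_succ]; push_cast; field_simp; ring
      rw [this]
      apply mul_le_of_le_one_right
      · rw [hc]; positivity
      · rw [div_le_one (by positivity)]
        have : (0:ℝ) ≤ K := K.cast_nonneg
        linarith
    have := (((exp_tendsto t).comp hE).mul_const c).sub (hf.sub hz)
    simpa using this

lemma choose_pair (M n : ℕ) : ∑ j ∈ Finset.range n, (M + 1).choose (2 * j + 1) =
    ∑ i ∈ Finset.range (2 * n), M.choose i := by
  induction n with
  | zero => simp
  | succ n ih =>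
    rw [Finset.sum_range_succ, ih, show 2 * (n + 1) = 2 * n + 1 + 1 by ring,
      Finset.sum_range_succ _ (2 * n + 1), Finset.sum_range_succ _ (2 * n), Nat.choose_succ_succ]
    ring

lemma alg1 (d : ℕ) : ∑ j ∈ Finset.range (d + 1),
    (1 : ℝ) / ((2 * (d - j) + 2).factorial * (2 * j + 1).factorial) =
      (2 ^ (2 * d + 2) - 1) / (2 * d + 3).factorial := by
  have h : ∑ j ∈ Finset.range (d + 1), (2 * d + 2 + 1).choose (2 * j + 1) + 1 = 2 ^ (2 * d + 2) := by
    rw [choose_pair, ← Nat.sum_range_choose, Finset.sum_range_succ _ (2 * d + 2)]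
    simp [mul_add]
  have h' : ∑ j ∈ Finset.range (d + 1), (((2 * d + 2 + 1).choose (2 * j + 1) : ℕ) : ℝ) =
      2 ^ (2 * d + 2) - 1 := by
    rw [eq_sub_iff_add_eq]; exact_mod_cast h
  rw [← h', Finset.sum_div]
  refine Finset.sum_congr rfl fun j hj => ?_
  have hj' : j ≤ d := by simpa [Nat.lt_succ_iff] using hj
  rw [Nat.cast_choose ℝ (by omega : 2 * j + 1 ≤ 2 * d + 2 + 1),
    show 2 * d + 2 + 1 - (2 * j + 1) = 2 * (d - j) + 2 by omega]
  field_simp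

lemma alg2 (d : ℕ) : ∑ j ∈ Finset.range (d + 1),
    (1 : ℝ) / ((2 * (d - j) + 3).factorial * (2 * j + 1).factorial) =
      (2 ^ (2 * d + 3) - (2 * d + 4)) / (2 * d + 4).factorial := by
  have h : ∑ j ∈ Finset.range (d + 1), (2 * d + 3 + 1).choose (2 * j + 1) + (2 * d + 4) =
      2 ^ (2 * d + 3) := by
    rw [choose_pair, ← Nat.sum_range_choose, Finset.sum_range_succ _ (2 * d + 3),
      Finset.sum_range_succ _ (2 * d + 2), Nat.choose_succ_self_right, Nat.choose_self]
    simp [mul_add]; ring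
  have h' : ∑ j ∈ Finset.range (d + 1), (((2 * d + 3 + 1).choose (2 * j + 1) : ℕ) : ℝ) =
      2 ^ (2 * d + 3) - (2 * d + 4) := by
    rw [eq_sub_iff_add_eq]; exact_mod_cast h
  rw [← h', Finset.sum_div]
  refine Finset.sum_congr rfl fun j hj => ?_
  have hj' : j ≤ d := by simpa [Nat.lt_succ_iff] using hj
  rw [Nat.cast_choose ℝ (by omega : 2 * j + 1 ≤ 2 * d + 3 + 1),
    show 2 * d + 3 + 1 - (2 * j + 1) = 2 * (d - j) + 3 by omega]
  field_simp

lemma alg (t : ℝ) (N : ℕ) :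
    ∑ d ∈ Finset.range N, ∑ j ∈ Finset.range (d + 1),
      (t ^ (2 * (d - j) + 2) / (2 * (d - j) + 2).factorial
        - t ^ (2 * (d - j) + 3) / (2 * (d - j) + 3).factorial) *
        (t ^ (2 * j + 1) / (2 * j + 1).factorial) =
    -((1 / 2) * ∑ i ∈ Finset.Icc 3 (2 * N + 2), (-2 * t) ^ i / (Nat.factorial i) +
          (1 - t) *
            ∑ i ∈ Finset.range N, t ^ (2 * i + 3) / (Nat.factorial (2 * i + 3))) := by
  induction N with
  | zero => simp
  | succ d ih =>
    rw [Finset.sum_range_succ, ih]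
    have e : ∑ j ∈ Finset.range (d + 1),
      (t ^ (2 * (d - j) + 2) / (2 * (d - j) + 2).factorial
        - t ^ (2 * (d - j) + 3) / (2 * (d - j) + 3).factorial) *
        (t ^ (2 * j + 1) / (2 * j + 1).factorial) =
        t ^ (2 * d + 3) * ((2 ^ (2 * d + 2) - 1) / (2 * d + 3).factorial)
        - t ^ (2 * d + 4) * ((2 ^ (2 * d + 3) - (2 * d + 4)) / (2 * d + 4).factorial) := by
      rw [← alg1, ← alg2, Finset.mul_sum, Finset.mul_sum, ← Finset.sum_sub_distrib]
      refine Finset.sum_congr rfl fun j hj => ?_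
      have hj' : j ≤ d := by simpa [Nat.lt_succ_iff] using hj
      obtain ⟨c, rfl⟩ := Nat.exists_eq_add_of_le hj'
      rw [show j + c - j = c by omega]
      field_simp
      ring
    rw [e, show 2 * (d + 1) + 2 = 2 * d + 2 + 1 + 1 by ring,
      Finset.sum_Icc_succ_top (b := 2 * d + 2 + 1) (by omega),
      Finset.sum_Icc_succ_top (b := 2 * d + 2) (by omega),
      Finset.sum_range_succ _ d]
    have p1 : (-2 * t) ^ (2 * d + 2 + 1) = - (2 ^ (2 * d + 3) * t ^ (2 * d + 3)) := by
      rw [← mul_pow, neg_mul]; exact Odd.neg_pow ⟨d + 1, by ring⟩ _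
    have p2 : (-2 * t) ^ (2 * d + 2 + 1 + 1) = 2 ^ (2 * d + 4) * t ^ (2 * d + 4) := by
      rw [← mul_pow, neg_mul]; exact Even.neg_pow ⟨d + 2, by ring⟩ _
    rw [p1, p2, show 2 * d + 2 + 1 + 1 = 2 * d + 4 by ring, show 2 * d + 2 + 1 = 2 * d + 3 by ring,
      show (2 * d + 4).factorial = (2 * d + 4) * (2 * d + 3).factorial from Nat.factorial_succ _]
    push_cast
    field_simp
    ring

lemma event_prob {P : Measure Om} (hP : IsUniformProduct P) (t : ℝ) (h0 : 0 ≤ t) (h1 : t ≤ 1)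
    (N : ℕ) (E : Set Om)
    (hE : ∀ T, Good T → T (-1) ≠ t → (T ∈ E ↔ (T 0 < t ∧ T ∉ O t (-1) ∧ T ∉ O t 0 ∧
      T ∈ O t ((2 * (N + 1) : ℕ) : ℤ)))) :
    P.real E = Real.exp (-2 * t) * ∑ d ∈ Finset.range N, ∑ j ∈ Finset.range (d + 1),
      (t ^ (2 * (d - j) + 2) / (2 * (d - j) + 2).factorial
        - t ^ (2 * (d - j) + 3) / (2 * (d - j) + 3).factorial) *
        (t ^ (2 * j + 1) / (2 * j + 1).factorial) := by
  have := prob hP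
  let F : Finset (Σ _ : ℕ, ℕ) := (Finset.range N).sigma (fun d => Finset.range (d + 1))
  let f : (Σ _ : ℕ, ℕ) → Set Om := fun x =>
    EA t ∩ (EB t (x.1 - x.2) ∩ EC t ((2 * (N + 1) : ℕ) : ℤ) x.2)
  have h2 : P.real E = P.real (⋃ x ∈ F, f x) := by
    apply measureReal_congr
    have hne : ∀ᵐ T ∂P, T (-1) ≠ t := by
      rw [ae_iff]; simpa using coord_ae hP (-1) t
    filter_upwards [ae_good hP, hne] with T hT hT2
    refine propext ?_
    change T ∈ E ↔ T ∈ ⋃ x ∈ F, f x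
    rw [hE T hT hT2, event_iff hT]
    simp only [mem_iUnion, F, f, Finset.mem_sigma, Finset.mem_range, exists_prop, Sigma.exists]
    constructor
    · rintro ⟨k, j, h, hh⟩
      refine ⟨k + j, j, ⟨by omega, by omega⟩, ?_⟩
      rwa [Nat.add_sub_cancel]
    · rintro ⟨d, j, ⟨h, h'⟩, hh⟩
      exact ⟨d - j, j, by omega, hh⟩
  have hm : ∀ x ∈ F, MeasurableSet (f x) := by
    intro x _
    exact (mS_le _ _ (EA_mS t)).inter ((mS_le univ _ (EB_mS univ _ _ fun _ _ => trivial)).inter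
      (mS_le univ _ (EC_mS univ _ _ _ fun _ _ => trivial)))
  rw [h2, measureReal_biUnion_finset ?_ hm]
  · simp only [F]
    rw [Finset.sum_sigma, Finset.mul_sum]
    refine Finset.sum_congr rfl fun d hd => ?_
    rw [Finset.mul_sum]
    refine Finset.sum_congr rfl fun j hj => ?_
    simp only [Finset.mem_range] at hd hj
    simp only [f]
    rw [triple hP t (N + 1) (d - j) j (by omega), EA_prob hP t h0 h1, EB_prob hP t h0 h1,
      EC_prob hP t h0 h1, show -2 * t = -t + -t by ring, Real.exp_add]
    ring
  · rintro ⟨d, j⟩ hx ⟨d', j'⟩ hx' hne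
    rw [Function.onFun, Set.disjoint_left]
    rintro T ⟨_, hB, hC⟩ ⟨_, hB', hC'⟩
    have u1 := ex_uniq hB.2 hB'.2
    have u2 := ex_uniq hC.2.1 hC'.2.1
    simp only [F, Finset.mem_coe, Finset.mem_sigma, Finset.mem_range] at hx hx' u1 u2
    apply hne
    obtain rfl : j = j' := by omega
    obtain rfl : d = d' := by omega
    rfl

lemma O_meas (t : ℝ) (s : ℤ) : MeasurableSet (O t s) := by
  have : O t s = {T | T s < t} ∩ ({T | Run (-1) s T} ∩ {T | Run 1 s T}) := by
    ext T; rw [mem_O]; rfl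
  rw [this]
  exact mS_le univ _ (@MeasurableSet.inter _ (mS _) _ _ (lt_mS _ _ _ trivial)
    (@MeasurableSet.inter _ (mS _) _ _ (run_mS _ _ _ fun _ => trivial)
      (run_mS _ _ _ fun _ => trivial)))

theorem gamma_two_add_four (P : Measure (ℤ → ℝ)) (hP : IsUniformProduct P)
    (t : ℝ) (ht : t ∈ Icc (0 : ℝ) 1) (s : ℕ) (hs : 2 ≤ s) (hse : Even s) :
    (P (D t s ∩ M2 t)).toReal + (P (D t s ∩ M4 t)).toReal =
      -Real.exp (-2 * t) *
        ((1 / 2) * ∑ i ∈ Finset.Icc 3 s, (-2 * t) ^ i / (Nat.factorial i) +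
          (1 - t) *
            ∑ i ∈ Finset.range (s / 2 - 1), t ^ (2 * i + 3) / (Nat.factorial (2 * i + 3))) := by
  have := prob hP
  obtain ⟨N, rfl⟩ : ∃ N, s = 2 * (N + 1) := by
    obtain ⟨r, hr⟩ := hse
    exact ⟨r - 1, by omega⟩
  have hM4 : MeasurableSet (D t ((2 * (N + 1) : ℕ) : ℤ) ∩ M4 t) := by
    refine (((O_meas _ _).compl.inter (O_meas _ _).compl).inter (O_meas _ _)).inter ?_
    exact (lt_meas 0 t).inter (measurableSet_lt measurable_const (measurable_pi_apply _))
  have hdisj : Disjoint (D t ((2 * (N + 1) : ℕ) : ℤ) ∩ M2 t)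
      (D t ((2 * (N + 1) : ℕ) : ℤ) ∩ M4 t) := by
    rw [Set.disjoint_left]
    rintro T ⟨_, h, _⟩ ⟨_, _, h'⟩
    exact lt_asymm h h'
  have key := event_prob hP t ht.1 ht.2 N
    ((D t ((2 * (N + 1) : ℕ) : ℤ) ∩ M2 t) ∪ (D t ((2 * (N + 1) : ℕ) : ℤ) ∩ M4 t)) (by
      intro T _ hne
      simp only [D, M2, M4, mem_union, mem_inter_iff, mem_compl_iff, Set.mem_ofPred_eq]
      have := lt_or_gt_of_ne hne
      tauto)
  rw [measureReal_union hdisj hM4, alg] at key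
  rw [show 2 * (N + 1) / 2 - 1 = N by omega]
  rw [show 2 * N + 2 = 2 * (N + 1) by ring] at key
  simp only [Measure.real] at key
  rw [key]
  ring
end
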